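/- arXiv:2408.11724 — 6 statements merged into one kernel-verified Lean document; each statement's English description precedes it below -/
import Mathlib

section
/- Suppose H₁ is co-sofic in G₁ and H₂ is co-sofic in G₂. Then H₁ × H₂ is co-sofic in G₁ × G₂. -/
universe u

/-- Normalized Hamming distance between two permutations of a (finite) type. -/
noncomputable def permDist {A : Type*} (σ τ : Equiv.Perm A) : ℝ :=
  (Set.ncard {a | σ a ≠ τ a} : ℝ) / (Nat.card A : ℝ)

/-- A group is sofic if every finite subset admits `(F, ε)`-approximations by permutations. -/
def IsSofic (G : Type*) [Group G] : Prop :=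
  ∀ (F : Finset G) (ε : ℝ), 0 < ε →
    ∃ A : Type, Finite A ∧ Nonempty A ∧ ∃ φ : G → Equiv.Perm A,
      φ 1 = 1 ∧
      (∀ g ∈ F, ∀ h ∈ F, permDist (φ (g * h)) (φ g * φ h) < ε) ∧
      (∀ g ∈ F, g ≠ 1 → 1 - ε < permDist (φ g) 1)


/-- A group is amenable if it carries a left-invariant finitely additive
probability measure defined on all subsets. -/
def IsAmenable (G : Type*) [Group G] : Prop :=
  ∃ m : Set G → ℝ,
    (∀ A : Set G, 0 ≤ m A) ∧
    m Set.univ = 1 ∧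
    (∀ A B : Set G, Disjoint A B → m (A ∪ B) = m A + m B) ∧
    (∀ (g : G) (A : Set G), m ((g * ·) '' A) = m A)


/-- A witness to co-soficity of the subgroup `H` of `G`. -/
structure CoSoficWitness {G : Type*} [Group G] (H : Subgroup G) where
  Gi : ℕ → Subgroup G
  Hi : ℕ → Subgroup G
  antitone_G : Antitone Gi
  antitone_H : Antitone Hi
  iInf_eq : ⨅ i, Gi i = H
  le : ∀ i, Hi i ≤ Gi i
  [normal : ∀ i, (Hi i).Normal]
  sofic : ∀ i, IsSofic (G ⧸ Hi i)
  amenable : ∀ i, IsAmenable (Gi i ⧸ (Hi i).subgroupOf (Gi i))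

/-- The subgroup `H` is co-sofic in `G`. -/
def CoSofic {G : Type*} [Group G] (H : Subgroup G) : Prop :=
  Nonempty (CoSoficWitness H)



lemma IsSofic.of_injective {G K : Type*} [Group G] [Group K] (f : G →* K)
    (hf : Function.Injective f) (h : IsSofic K) : IsSofic G := by
  classical
  intro F ε hε
  obtain ⟨A, hA, hA', φ, h1, h2, h3⟩ := h (F.image f) ε hε
  refine ⟨A, hA, hA', fun g => φ (f g), by simp [h1], ?_, ?_⟩
  · intro g hg k hk
    simpa using h2 (f g) (Finset.mem_image_of_mem _ hg) (f k) (Finset.mem_image_of_mem _ hk)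
  · intro g hg hne
    exact h3 (f g) (Finset.mem_image_of_mem _ hg) (by
      intro h; exact hne (hf (by simpa using h)))

lemma one_sub_permDist {A : Type*} [Finite A] [Nonempty A] (σ τ : Equiv.Perm A) :
    1 - permDist σ τ = (Set.ncard {a | σ a = τ a} : ℝ) / (Nat.card A : ℝ) := by
  have hc : (0 : ℝ) < Nat.card A := by exact_mod_cast Nat.card_pos
  have h := Set.ncard_add_ncard_compl {a | σ a = τ a}
  have h' : {a | σ a = τ a}ᶜ = {a | σ a ≠ τ a} := rfl
  rw [h'] at h
  unfold permDist
  rw [← h] at hc ⊢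
  push_cast at hc ⊢
  field_simp
  ring

lemma permDist_prod {A B : Type*} [Finite A] [Nonempty A] [Finite B] [Nonempty B]
    (σ τ : Equiv.Perm A) (σ' τ' : Equiv.Perm B) :
    1 - permDist (Equiv.prodCongr σ σ') (Equiv.prodCongr τ τ') =
      (1 - permDist σ τ) * (1 - permDist σ' τ') := by
  have : {a | (Equiv.prodCongr σ σ') a = (Equiv.prodCongr τ τ') a} =
      {a | σ a = τ a} ×ˢ {a | σ' a = τ' a} := by
    ext ⟨a, b⟩; simp
  rw [one_sub_permDist (A := A × B), one_sub_permDist, one_sub_permDist, this, Set.ncard_prod,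
    Nat.card_prod]
  push_cast
  rw [mul_div_mul_comm]

lemma permDist_nonneg {A : Type*} (σ τ : Equiv.Perm A) : 0 ≤ permDist σ τ := by
  unfold permDist; positivity

lemma permDist_le_one {A : Type*} [Finite A] [Nonempty A] (σ τ : Equiv.Perm A) :
    permDist σ τ ≤ 1 := by
  have := one_sub_permDist σ τ
  have h : 0 ≤ (Set.ncard {a | σ a = τ a} : ℝ) / (Nat.card A : ℝ) := by positivity
  linarith

lemma IsSofic.prod {G K : Type*} [Group G] [Group K] (hG : IsSofic G) (hK : IsSofic K) :
    IsSofic (G × K) := by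
  classical
  intro F ε hε
  obtain ⟨A, hA, hA', φ, h1, h2, h3⟩ := hG (F.image Prod.fst) (ε / 2) (by positivity)
  obtain ⟨B, hB, hB', ψ, k1, k2, k3⟩ := hK (F.image Prod.snd) (ε / 2) (by positivity)
  refine ⟨A × B, inferInstance, inferInstance, fun g => Equiv.prodCongr (φ g.1) (ψ g.2), ?_, ?_, ?_⟩
  · ext x <;> simp [h1, k1]
  · intro g hg h hh
    have e1 := h2 g.1 (Finset.mem_image_of_mem _ hg) h.1 (Finset.mem_image_of_mem _ hh)
    have e2 := k2 g.2 (Finset.mem_image_of_mem _ hg) h.2 (Finset.mem_image_of_mem _ hh)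
    have e := permDist_prod (φ (g.1 * h.1)) (φ g.1 * φ h.1) (ψ (g.2 * h.2)) (ψ g.2 * ψ h.2)
    have hm : (Equiv.prodCongr (φ g.1) (ψ g.2) * Equiv.prodCongr (φ h.1) (ψ h.2) :
        Equiv.Perm (A × B)) = Equiv.prodCongr (φ g.1 * φ h.1) (ψ g.2 * ψ h.2) := by
      ext x <;> simp
    change permDist (Equiv.prodCongr (φ (g.1 * h.1)) (ψ (g.2 * h.2)))
      (Equiv.prodCongr (φ g.1) (ψ g.2) * Equiv.prodCongr (φ h.1) (ψ h.2)) < ε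
    rw [hm]
    have := mul_nonneg (permDist_nonneg (φ (g.1 * h.1)) (φ g.1 * φ h.1))
      (permDist_nonneg (ψ (g.2 * h.2)) (ψ g.2 * ψ h.2))
    linarith
  · intro g hg hne
    have e := permDist_prod (φ g.1) 1 (ψ g.2) 1
    have hm : (Equiv.prodCongr 1 1 : Equiv.Perm (A × B)) = 1 := by ext x <;> simp
    rw [hm] at e
    have a0 := permDist_nonneg (φ g.1) 1
    have a1 := permDist_le_one (φ g.1) 1
    have b0 := permDist_nonneg (ψ g.2) 1
    have b1 := permDist_le_one (ψ g.2) 1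
    have : g.1 ≠ 1 ∨ g.2 ≠ 1 := by
      by_contra! hc
      exact hne (Prod.ext hc.1 hc.2)
    rcases this with h | h
    · have := h3 g.1 (Finset.mem_image_of_mem _ hg) h
      dsimp only
      nlinarith
    · have := k3 g.2 (Finset.mem_image_of_mem _ hg) h
      dsimp only
      nlinarith

lemma IsAmenable.of_mulEquiv {G K : Type*} [Group G] [Group K] (f : K ≃* G)
    (h : IsAmenable K) : IsAmenable G := by
  obtain ⟨m, h0, h1, h2, h3⟩ := h
  refine ⟨fun A => m (f ⁻¹' A), fun A => h0 _, by simpa using h1, ?_, ?_⟩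
  · intro A B hAB
    simpa using h2 _ _ (hAB.preimage f)
  · intro g A
    dsimp only
    rw [← h3 (f.symm g) (f ⁻¹' A)]
    congr 1
    ext x
    simp only [Set.mem_preimage, Set.mem_image]
    constructor
    · rintro ⟨a, ha, e⟩
      exact ⟨f.symm a, by simpa using ha, by rw [← map_mul, e]; simp⟩
    · rintro ⟨a, ha, rfl⟩
      exact ⟨f a, ha, by simp⟩

section mean
variable {X : Type*} (m : Set X → ℝ)

lemma fa_empty (h2 : ∀ A B : Set X, Disjoint A B → m (A ∪ B) = m A + m B) : m ∅ = 0 := by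
  have := h2 ∅ ∅ (by simp)
  simp at this
  exact this

lemma fa_preimage (h2 : ∀ A B : Set X, Disjoint A B → m (A ∪ B) = m A + m B)
    {ι : Type*} [DecidableEq ι] (w : X → ι) (s : Finset ι) :
    m (w ⁻¹' (s : Set ι)) = ∑ i ∈ s, m (w ⁻¹' {i}) := by
  induction s using Finset.induction_on with
  | empty => simp [fa_empty m h2]
  | insert a s ha ih =>
    rw [Finset.sum_insert ha, ← ih, ← h2, Finset.coe_insert, Set.insert_eq, Set.preimage_union]
    refine Disjoint.preimage w ?_
    simpa using ha

lemma fa_push (h2 : ∀ A B : Set X, Disjoint A B → m (A ∪ B) = m A + m B)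
    {ι κ : Type*} [Fintype ι] [DecidableEq ι] [Fintype κ] [DecidableEq κ]
    (w : X → ι) (h : ι → κ) (c : κ → ℝ) :
    ∑ k, c k * m ((fun x => h (w x)) ⁻¹' {k}) = ∑ i, c (h i) * m (w ⁻¹' {i}) := by
  rw [← Finset.sum_fiberwise (s := Finset.univ) (g := h)]
  refine Finset.sum_congr rfl fun k _ => ?_
  have : (fun x => h (w x)) ⁻¹' {k} = w ⁻¹' ((Finset.univ.filter fun i => h i = k : Finset ι) : Set ι) := by
    ext x; simp
  rw [this, fa_preimage m h2, Finset.mul_sum]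
  refine Finset.sum_congr rfl fun i hi => ?_
  rw [(Finset.mem_filter.1 hi).2]

noncomputable def quant (n : ℕ) (f : X → ℝ) (x : X) : Fin (n + 1) :=
  ⟨min ⌊(n : ℝ) * f x⌋₊ n, by omega⟩

noncomputable def approxI (n : ℕ) (f : X → ℝ) : ℝ :=
  ∑ j : Fin (n + 1), ((j : ℕ) / (n : ℝ)) * m (quant n f ⁻¹' {j})

lemma fa_total (h1 : m Set.univ = 1)
    (h2 : ∀ A B : Set X, Disjoint A B → m (A ∪ B) = m A + m B)
    {ι : Type*} [Fintype ι] [DecidableEq ι] (w : X → ι) : ∑ i, m (w ⁻¹' {i}) = 1 := by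
  rw [← fa_preimage m h2]; simpa using h1

lemma approxI_mem (h0 : ∀ A, 0 ≤ m A) (h1 : m Set.univ = 1)
    (h2 : ∀ A B : Set X, Disjoint A B → m (A ∪ B) = m A + m B) (n : ℕ) (f : X → ℝ) :
    approxI m n f ∈ Set.Icc (0 : ℝ) 1 := by
  constructor
  · exact Finset.sum_nonneg fun i _ => mul_nonneg (by positivity) (h0 _)
  · rw [← fa_total m h1 h2 (quant n f)]
    refine Finset.sum_le_sum fun i _ => ?_
    refine mul_le_of_le_one_left (h0 _) (div_le_one_of_le₀ ?_ (by positivity))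
    exact_mod_cast Nat.lt_succ_iff.1 i.2

lemma quant_bound (n : ℕ) (f : X → ℝ) (x : X) (hf : 0 ≤ f x) (hf' : f x ≤ 1) :
    ((quant n f x : ℕ) : ℝ) ≤ n * f x ∧ n * f x < (quant n f x : ℕ) + 1 := by
  have hq : (quant n f x : ℕ) = ⌊(n : ℝ) * f x⌋₊ := by
    refine min_eq_left ?_
    refine Nat.floor_le_of_le ?_
    exact mul_le_of_le_one_right (by positivity) hf'
  rw [hq]
  exact ⟨Nat.floor_le (by positivity), Nat.lt_floor_add_one _⟩

lemma approxI_add (h0 : ∀ A, 0 ≤ m A) (h1 : m Set.univ = 1)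
    (h2 : ∀ A B : Set X, Disjoint A B → m (A ∪ B) = m A + m B) (n : ℕ) (f g : X → ℝ)
    (hf : ∀ x, 0 ≤ f x) (hg : ∀ x, 0 ≤ g x) (hfg : ∀ x, f x + g x ≤ 1) :
    |approxI m n (fun x => f x + g x) - (approxI m n f + approxI m n g)| ≤ 2 * (1 / (n : ℝ)) := by
  let w : X → Fin (n + 1) × Fin (n + 1) × Fin (n + 1) :=
    fun x => (quant n (fun x => f x + g x) x, quant n f x, quant n g x)
  have e1 := fa_push m h2 w (fun p => p.1) (fun j => ((j : ℕ) / (n : ℝ)))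
  have e2 := fa_push m h2 w (fun p => p.2.1) (fun j => ((j : ℕ) / (n : ℝ)))
  have e3 := fa_push m h2 w (fun p => p.2.2) (fun j => ((j : ℕ) / (n : ℝ)))
  change approxI m n (fun x => f x + g x) = _ at e1
  change approxI m n f = _ at e2
  change approxI m n g = _ at e3
  rw [e1, e2, e3, ← Finset.sum_add_distrib, ← Finset.sum_sub_distrib]
  refine (Finset.abs_sum_le_sum_abs _ _).trans ?_
  have ht : 2 * (1 / (n : ℝ)) = ∑ i, 2 * (1 / (n : ℝ)) * m (w ⁻¹' {i}) := by
    rw [← Finset.mul_sum, fa_total m h1 h2 w, mul_one]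
  rw [ht]
  refine Finset.sum_le_sum fun i _ => ?_
  by_cases hi : ∃ x, w x = i
  · obtain ⟨x, rfl⟩ := hi
    rw [← add_mul, ← sub_mul, abs_mul, abs_of_nonneg (h0 _)]
    refine mul_le_mul_of_nonneg_right ?_ (h0 _)
    have b1 := quant_bound n (fun x => f x + g x) x (add_nonneg (hf x) (hg x)) (hfg x)
    have b2 := quant_bound n f x (hf x) (by linarith [hfg x, hg x])
    have b3 := quant_bound n g x (hg x) (by linarith [hfg x, hf x])
    dsimp only [w] at b1 ⊢
    rw [← add_div, ← sub_div, abs_div, abs_of_nonneg (Nat.cast_nonneg n : (0 : ℝ) ≤ n),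
      mul_one_div]
    refine div_le_div_of_nonneg_right ?_ (Nat.cast_nonneg n)
    rw [abs_le]
    constructor <;> nlinarith
  · have : w ⁻¹' {i} = ∅ := by
      ext x; simp only [Set.mem_preimage, Set.mem_singleton_iff, Set.mem_empty_iff_false, iff_false]
      exact fun h => hi ⟨x, h⟩
    simp [this, fa_empty m h2]

lemma approxI_one (h1 : m Set.univ = 1)
    (h2 : ∀ A B : Set X, Disjoint A B → m (A ∪ B) = m A + m B) (n : ℕ) (hn : n ≠ 0) :
    approxI m n (fun _ => 1) = 1 := by
  unfold approxI
  refine Eq.trans ?_ (fa_total m h1 h2 (quant n (fun _ : X => (1 : ℝ))))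
  refine Finset.sum_congr rfl fun i _ => ?_
  by_cases hi : i = Fin.last n
  · subst hi
    have : (n : ℝ) ≠ 0 := by exact_mod_cast hn
    simp [this]
  · have : quant n (fun _ : X => (1 : ℝ)) ⁻¹' {i} = ∅ := by
      ext x
      simp only [Set.mem_preimage, Set.mem_singleton_iff, Set.mem_empty_iff_false, iff_false]
      rintro rfl
      apply hi
      ext
      simp [quant]
    simp [this, fa_empty m h2]

lemma exists_mean (h0 : ∀ A, 0 ≤ m A) (h1 : m Set.univ = 1)
    (h2 : ∀ A B : Set X, Disjoint A B → m (A ∪ B) = m A + m B) :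
    ∃ I : (X → ℝ) → ℝ, (∀ f, 0 ≤ I f) ∧ I (fun _ => 1) = 1 ∧
      (∀ f g : X → ℝ, (∀ x, 0 ≤ f x) → (∀ x, 0 ≤ g x) → (∀ x, f x + g x ≤ 1) →
        I (fun x => f x + g x) = I f + I g) ∧
      (∀ e : X → X, (∀ A, m (e ⁻¹' A) = m A) → ∀ f : X → ℝ, I (fun x => f (e x)) = I f) := by
  have key : ∀ f : X → ℝ, ∃ a ∈ Set.Icc (0 : ℝ) 1,
      Filter.Tendsto (fun n => approxI m n f) (Filter.hyperfilter ℕ) (nhds a) := by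
    intro f
    have := (isCompact_Icc (a := (0 : ℝ)) (b := 1)).ultrafilter_le_nhds
      ((Filter.hyperfilter ℕ).map (fun n => approxI m n f))
      (by
        rw [Filter.le_principal_iff]
        exact Filter.mem_map.2 (Filter.univ_mem' fun n => approxI_mem m h0 h1 h2 n f))
    exact this
  choose I hI hlim using key
  have hle : (Filter.hyperfilter ℕ : Filter ℕ) ≤ Filter.atTop := by
    rw [← Nat.cofinite_eq_atTop]; exact Filter.hyperfilter_le_cofinite
  refine ⟨I, fun f => (hI f).1, ?_, ?_, ?_⟩
  · refine tendsto_nhds_unique (hlim _) (tendsto_const_nhds.congr' ?_)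
    have := hle (Filter.eventually_ne_atTop 0)
    filter_upwards [this] with n hn
    exact (approxI_one m h1 h2 n hn).symm
  · intro f g hf hg hfg
    have t1 := (hlim (fun x => f x + g x)).sub ((hlim f).add (hlim g))
    have t2 : Filter.Tendsto (fun n : ℕ => 2 * (1 / (n : ℝ))) (Filter.hyperfilter ℕ)
        (nhds (2 * 0)) :=
      (tendsto_one_div_atTop_nhds_zero_nat.mono_left hle).const_mul 2
    rw [mul_zero] at t2
    have t3 : Filter.Tendsto (fun n => approxI m n (fun x => f x + g x) -
        (approxI m n f + approxI m n g)) (Filter.hyperfilter ℕ) (nhds 0) :=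
      squeeze_zero_norm (fun n => approxI_add m h0 h1 h2 n f g hf hg hfg) t2
    have := tendsto_nhds_unique t1 t3
    linarith
  · intro e he f
    refine tendsto_nhds_unique (hlim _) ((hlim f).congr fun n => ?_)
    unfold approxI
    refine Finset.sum_congr rfl fun j _ => ?_
    rw [← he (quant n f ⁻¹' {j})]
    rfl

end mean

lemma IsAmenable.prod {G K : Type*} [Group G] [Group K] (hG : IsAmenable G) (hK : IsAmenable K) :
    IsAmenable (G × K) := by
  obtain ⟨m, h0, h1, h2, h3⟩ := hG
  obtain ⟨l, k0, k1, k2, k3⟩ := hK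
  obtain ⟨I, i0, i1, i2, i3⟩ := exists_mean l k0 k1 k2
  have hle : ∀ A, m A ≤ 1 := by
    intro A
    have := h2 A Aᶜ disjoint_compl_right
    rw [Set.union_compl_self, h1] at this
    linarith [h0 Aᶜ]
  refine ⟨fun E => I (fun y => m {x | (x, y) ∈ E}), fun E => i0 _, ?_, ?_, ?_⟩
  · simpa [h1] using i1
  · intro A B hAB
    have e : ∀ y, m {x | (x, y) ∈ A ∪ B} = m {x | (x, y) ∈ A} + m {x | (x, y) ∈ B} := by
      intro y
      exact h2 _ _ (hAB.preimage (fun x => (x, y)))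
    simp only [e]
    refine i2 _ _ (fun _ => h0 _) (fun _ => h0 _) fun y => ?_
    rw [← e]; exact hle _
  · rintro ⟨g, k⟩ A
    dsimp only
    rw [← i3 (fun y => k⁻¹ * y) ?_ (fun y => m {x | (x, y) ∈ A})]
    · congr 1
      ext y
      rw [← h3 g {x | (x, k⁻¹ * y) ∈ A}]
      congr 1
      ext x
      simp only [Set.mem_image, Set.mem_setOf_eq, Prod.exists, Prod.mk_mul_mk, Prod.mk.injEq]
      constructor
      · rintro ⟨a, b, hab, rfl, rfl⟩
        exact ⟨a, by simpa using hab, rfl⟩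
      · rintro ⟨a, ha, rfl⟩
        exact ⟨a, k⁻¹ * y, ha, rfl, by simp⟩
    · intro B
      rw [← k3 k B]
      congr 1
      ext x
      simp only [Set.mem_preimage, Set.mem_image]
      constructor
      · intro h; exact ⟨_, h, by simp⟩
      · rintro ⟨a, ha, rfl⟩; simpa using ha

lemma prodQuot_sofic {G₁ G₂ : Type*} [Group G₁] [Group G₂] (N₁ : Subgroup G₁) (N₂ : Subgroup G₂)
    [N₁.Normal] [N₂.Normal] (h₁ : IsSofic (G₁ ⧸ N₁)) (h₂ : IsSofic (G₂ ⧸ N₂)) :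
    IsSofic ((G₁ × G₂) ⧸ N₁.prod N₂) := by
  let f : G₁ × G₂ →* (G₁ ⧸ N₁) × (G₂ ⧸ N₂) :=
    (QuotientGroup.mk' N₁).prodMap (QuotientGroup.mk' N₂)
  have hk : f.ker = N₁.prod N₂ := by
    ext ⟨a, b⟩
    simp [f, MonoidHom.mem_ker, Subgroup.mem_prod]
  exact IsSofic.of_injective ((QuotientGroup.kerLift f).comp
    (QuotientGroup.quotientMulEquivOfEq hk.symm).toMonoidHom)
    ((QuotientGroup.kerLift_injective f).comp (MulEquiv.injective _)) (h₁.prod h₂)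

lemma prodQuot_amenable {G₁ G₂ : Type*} [Group G₁] [Group G₂] (K₁ N₁ : Subgroup G₁)
    (K₂ N₂ : Subgroup G₂)
    [N₁.Normal] [N₂.Normal] (h₁ : IsAmenable (K₁ ⧸ N₁.subgroupOf K₁))
    (h₂ : IsAmenable (K₂ ⧸ N₂.subgroupOf K₂)) :
    IsAmenable (K₁.prod K₂ ⧸ (N₁.prod N₂).subgroupOf (K₁.prod K₂)) := by
  let f : K₁.prod K₂ →* (K₁ ⧸ N₁.subgroupOf K₁) × (K₂ ⧸ N₂.subgroupOf K₂) :=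
    ((QuotientGroup.mk' (N₁.subgroupOf K₁)).prodMap (QuotientGroup.mk' (N₂.subgroupOf K₂))).comp
      (K₁.prodEquiv K₂).toMonoidHom
  have hk : f.ker = (N₁.prod N₂).subgroupOf (K₁.prod K₂) := by
    ext ⟨⟨a, b⟩, hab⟩
    have e : f ⟨(a, b), hab⟩ = (((⟨a, hab.1⟩ : K₁) : K₁ ⧸ N₁.subgroupOf K₁),
      ((⟨b, hab.2⟩ : K₂) : K₂ ⧸ N₂.subgroupOf K₂)) := rfl
    rw [MonoidHom.mem_ker, e, Prod.mk_eq_one, QuotientGroup.eq_one_iff, QuotientGroup.eq_one_iff]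
    simp [Subgroup.mem_prod, Subgroup.mem_subgroupOf]
  have hs : Function.Surjective f :=
    ((QuotientGroup.mk'_surjective _).prodMap (QuotientGroup.mk'_surjective _)).comp
      (MulEquiv.surjective _)
  exact IsAmenable.of_mulEquiv ((QuotientGroup.quotientKerEquivOfSurjective f hs).symm.trans
    (QuotientGroup.quotientMulEquivOfEq hk)) (h₁.prod h₂)

/-- Co-soficity is preserved under direct products. -/
theorem coSofic_prod {G₁ G₂ : Type*} [Group G₁] [Group G₂]
    (H₁ : Subgroup G₁) (H₂ : Subgroup G₂)
    (h₁ : CoSofic H₁) (h₂ : CoSofic H₂) :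
    CoSofic (H₁.prod H₂) := by
  obtain ⟨w⟩ := h₁
  obtain ⟨v⟩ := h₂
  have := w.normal
  have := v.normal
  exact ⟨{
    Gi := fun i => (w.Gi i).prod (v.Gi i)
    Hi := fun i => (w.Hi i).prod (v.Hi i)
    antitone_G := fun i j h => Subgroup.prod_mono (w.antitone_G h) (v.antitone_G h)
    antitone_H := fun i j h => Subgroup.prod_mono (w.antitone_H h) (v.antitone_H h)
    iInf_eq := by
      refine Eq.trans ?_ (congrArg₂ Subgroup.prod w.iInf_eq v.iInf_eq)
      ext x
      simp [Subgroup.mem_iInf, Subgroup.mem_prod, forall_and]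
    le := fun i => Subgroup.prod_mono (w.le i) (v.le i)
    normal := fun i => inferInstance
    sofic := fun i => prodQuot_sofic _ _ (w.sofic i) (v.sofic i)
    amenable := fun i => prodQuot_amenable _ _ _ _ (w.amenable i) (v.amenable i) }⟩
end

section
/- Suppose H₁ is σ-co-sofic in G₁ and H₂ is σ-co-sofic in G₂. Then H₁ × H₂ is σ-co-sofic in G₁ × G₂. -/
universe u

/-- The subgroup `H` is σ-co-sofic in `G`. -/
def SigmaCoSofic {G : Type*} [Group G] (H : Subgroup G) : Prop :=
  ∃ Gi Hi : ℕ → Subgroup G,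
    Monotone Gi ∧ Monotone Hi ∧
    (⨆ i, Gi i) = ⊤ ∧ (⨆ i, Hi i) = H ∧
    (∀ i, Hi i ≤ Gi i) ∧
    ∀ i, CoSofic ((Hi i).subgroupOf (Gi i))


open MeasureTheory Filter Topology in
theorem exists_mean_aux {X : Type*} (m : Set X → ℝ) (h0 : ∀ A, 0 ≤ m A) (h1 : m Set.univ = 1)
    (hadd : ∀ A B : Set X, Disjoint A B → m (A ∪ B) = m A + m B) :
    ∃ I : (X → ℝ) → ℝ, (∀ f, 0 ≤ I f) ∧ I (fun _ => 1) = 1 ∧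
      (∀ f g : X → ℝ, (∀ x, 0 ≤ f x) → (∀ x, 0 ≤ g x) → (∀ x, f x + g x ≤ 1) →
        I (fun x => f x + g x) = I f + I g) ∧
      (∀ e : X ≃ X, (∀ A, m (e ⁻¹' A) = m A) → ∀ f, I (fun x => f (e x)) = I f) := by
  classical
  letI : MeasurableSpace X := ⊤
  let μ : Measure X := 0
  let T : Set X → ℝ →L[ℝ] ℝ := fun s => m s • ContinuousLinearMap.id ℝ ℝ
  have hT : FinMeasAdditive μ T := by
    intro s t _ _ _ _ hst
    simp only [T]
    rw [hadd s t hst, add_smul]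
  have hint : ∀ f : SimpleFunc X ℝ, Integrable f μ := fun f => integrable_zero_measure
  have hme : m ∅ = 0 := by
    have := hadd ∅ ∅ (by simp)
    simp at this
    exact this
  have hTe : T ∅ = 0 := by simp [T, hme]
  have hTn : ∀ s : Set X, ∀ x : ℝ, 0 ≤ x → 0 ≤ T s x := by
    intro s x hx
    simp only [T, ContinuousLinearMap.smul_apply, ContinuousLinearMap.id_apply, smul_eq_mul]
    exact mul_nonneg (h0 s) hx
  let J : SimpleFunc X ℝ → ℝ := fun f => SimpleFunc.setToSimpleFunc T f
  have Jmono : ∀ f g : SimpleFunc X ℝ, (∀ x, f x ≤ g x) → J f ≤ J g := fun f g h =>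
    SimpleFunc.setToSimpleFunc_mono hT (fun s _ _ x hx => hTn s x hx) (hint f) (hint g) h
  have Jadd : ∀ f g : SimpleFunc X ℝ, J (f + g) = J f + J g := fun f g =>
    SimpleFunc.setToSimpleFunc_add T hT (hint f) (hint g)
  have Jconst : ∀ c : ℝ, J (SimpleFunc.const X c) = c := by
    intro c
    have := SimpleFunc.setToSimpleFunc_const T hTe c (m := ⊤)
    simp only [J]
    rw [this]
    simp [T, h1]
  let q : ℕ → (X → ℝ) → SimpleFunc X ℝ := fun n f =>
    { toFun := fun x => ((min ⌊((n:ℝ)+1) * f x⌋₊ (n+1) : ℕ) : ℝ) / ((n:ℝ)+1)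
      measurableSet_fiber' := fun _ => trivial
      finite_range' := by
        refine Set.Finite.subset ((Set.finite_Iic (n+1)).image
          (fun k : ℕ => (k:ℝ) / ((n:ℝ)+1))) ?_
        rintro _ ⟨x, rfl⟩
        exact ⟨_, Set.mem_Iic.2 (min_le_right _ _), rfl⟩ }
  have hq : ∀ n f x, q n f x = ((min ⌊((n:ℝ)+1) * f x⌋₊ (n+1) : ℕ) : ℝ) / ((n:ℝ)+1) :=
    fun _ _ _ => rfl
  have hqn : ∀ n f, 0 ≤ J (q n f) := by
    intro n f
    have := Jmono (SimpleFunc.const X 0) (q n f) (fun x => by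
      rw [hq]; simp only [SimpleFunc.const_apply]; positivity)
    rwa [Jconst] at this
  have hq1 : ∀ n f, J (q n f) ≤ 1 := by
    intro n f
    have := Jmono (q n f) (SimpleFunc.const X 1) (fun x => by
      rw [hq]; simp only [SimpleFunc.const_apply]
      rw [div_le_one (by positivity)]
      exact_mod_cast min_le_right _ _)
    rwa [Jconst] at this
  have hlim : ∀ f, ∃ l : ℝ, Tendsto (fun n => J (q n f)) (hyperfilter ℕ : Filter ℕ) (𝓝 l) := by
    intro f
    obtain ⟨l, _, hl⟩ := (isCompact_Icc (a := (0:ℝ)) (b := 1)).ultrafilter_le_nhds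
      ((hyperfilter ℕ).map (fun n => J (q n f))) (by
        rw [le_principal_iff]
        exact Filter.mem_map.2 (Filter.univ_mem' (fun n => ⟨hqn n f, hq1 n f⟩)))
    exact ⟨l, hl⟩
  choose I hI using hlim
  refine ⟨I, ?_, ?_, ?_, ?_⟩
  · intro f
    exact ge_of_tendsto' (hI f) (fun n => hqn n f)
  · refine tendsto_nhds_unique (hI _) ?_
    refine tendsto_const_nhds.congr (fun n => ?_)
    have : q n (fun _ => 1) = SimpleFunc.const X 1 := by
      ext x
      rw [hq]
      have h2 : ⌊((n:ℝ)+1) * 1⌋₊ = n + 1 := by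
        rw [mul_one]; exact_mod_cast Nat.floor_natCast (R := ℝ) (n+1)
      rw [h2]
      simp only [min_self, SimpleFunc.const_apply]
      push_cast
      exact div_self (by positivity)
    rw [this, Jconst]
  · intro f g hf hg hfg
    have hval : ∀ (h : X → ℝ), (∀ x, h x ≤ 1) → ∀ n x,
        q n h x = (⌊((n:ℝ)+1) * h x⌋₊ : ℝ) / ((n:ℝ)+1) := by
      intro h hh n x
      rw [hq, min_eq_left]
      have h3 : ((n:ℝ)+1) * h x ≤ ((n+1 : ℕ) : ℝ) := by
        push_cast
        exact mul_le_of_le_one_right (by positivity) (hh x)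
      exact Nat.floor_le_of_le h3
    have hf1 : ∀ x, f x ≤ 1 := fun x => by linarith [hfg x, hg x]
    have hg1 : ∀ x, g x ≤ 1 := fun x => by linarith [hfg x, hf x]
    have hlow : ∀ n, J (q n f) + J (q n g) ≤ J (q n (fun x => f x + g x)) := by
      intro n
      rw [← Jadd]
      apply Jmono
      intro x
      rw [SimpleFunc.add_apply, hval _ hf1, hval _ hg1, hval _ hfg, ← add_div]
      gcongr
      have a1 : 0 ≤ ((n:ℝ)+1) * f x := mul_nonneg (by positivity) (hf x)
      have a2 : 0 ≤ ((n:ℝ)+1) * g x := mul_nonneg (by positivity) (hg x)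
      have : ⌊((n:ℝ)+1) * f x⌋₊ + ⌊((n:ℝ)+1) * g x⌋₊ ≤ ⌊((n:ℝ)+1) * (f x + g x)⌋₊ := by
        apply Nat.le_floor
        push_cast
        linarith [Nat.floor_le a1, Nat.floor_le a2]
      exact_mod_cast this
    have hup : ∀ n, J (q n (fun x => f x + g x)) ≤ J (q n f) + J (q n g) + 1 / ((n:ℝ)+1) := by
      intro n
      rw [← Jadd, ← Jconst (1 / ((n:ℝ)+1)), ← Jadd]
      apply Jmono
      intro x
      rw [SimpleFunc.add_apply, SimpleFunc.add_apply, hval _ hf1, hval _ hg1, hval _ hfg,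
        SimpleFunc.const_apply, ← add_div, ← add_div]
      gcongr
      have a1 : 0 ≤ ((n:ℝ)+1) * (f x + g x) :=
        mul_nonneg (by positivity) (add_nonneg (hf x) (hg x))
      have : ⌊((n:ℝ)+1) * (f x + g x)⌋₊ <
          ⌊((n:ℝ)+1) * f x⌋₊ + ⌊((n:ℝ)+1) * g x⌋₊ + 2 := by
        rw [Nat.floor_lt a1]
        push_cast
        linarith [Nat.lt_floor_add_one (((n:ℝ)+1) * f x), Nat.lt_floor_add_one (((n:ℝ)+1) * g x)]
      have : ⌊((n:ℝ)+1) * (f x + g x)⌋₊ ≤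
          ⌊((n:ℝ)+1) * f x⌋₊ + ⌊((n:ℝ)+1) * g x⌋₊ + 1 := by omega
      exact_mod_cast this
    have hz : Tendsto (fun n : ℕ => 1 / ((n:ℝ)+1)) (hyperfilter ℕ : Filter ℕ) (𝓝 0) :=
      tendsto_one_div_add_atTop_nhds_zero_nat.mono_left Nat.hyperfilter_le_atTop
    apply le_antisymm
    · have := le_of_tendsto_of_tendsto' (hI (fun x => f x + g x))
        (((hI f).add (hI g)).add hz) hup
      simpa using this
    · exact le_of_tendsto_of_tendsto' ((hI f).add (hI g)) (hI (fun x => f x + g x)) hlow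
  · intro e he f
    refine tendsto_nhds_unique (hI _) ((hI f).congr (fun n => ?_))
    have hr : (q n (fun x => f (e x))).range = (q n f).range := by
      ext y
      simp only [SimpleFunc.mem_range, Set.mem_range]
      constructor
      · rintro ⟨x, hx⟩
        exact ⟨e x, hx⟩
      · rintro ⟨x, hx⟩
        refine ⟨e.symm x, ?_⟩
        rw [← hx, hq, hq, e.apply_symm_apply]
    simp only [J, SimpleFunc.setToSimpleFunc]
    rw [hr]
    refine Finset.sum_congr rfl (fun y _ => ?_)
    have : (q n (fun x => f (e x))) ⁻¹' {y} = e ⁻¹' ((q n f) ⁻¹' {y}) := rfl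
    simp only [T]
    rw [this, he]

theorem IsAmenable.prod_aux {G H : Type*} [Group G] [Group H] (hG : IsAmenable G)
    (hH : IsAmenable H) : IsAmenable (G × H) := by
  obtain ⟨m, m0, m1, madd, minv⟩ := hG
  obtain ⟨k, k0, k1, kadd, kinv⟩ := hH
  obtain ⟨I, I0, I1, Iadd, Iinv⟩ := exists_mean_aux m m0 m1 madd
  have kle : ∀ A, k A ≤ 1 := by
    intro A
    have := kadd A Aᶜ disjoint_compl_right
    rw [Set.union_compl_self, k1] at this
    linarith [k0 Aᶜ]
  refine ⟨fun A => I (fun x => k {y | (x, y) ∈ A}), fun A => I0 _, ?_, ?_, ?_⟩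
  · simp only [Set.mem_univ, Set.setOf_true, k1, I1]
  · intro A B hAB
    have hs : ∀ x, k {y | (x, y) ∈ A ∪ B} = k {y | (x, y) ∈ A} + k {y | (x, y) ∈ B} := by
      intro x
      rw [← kadd]
      · rfl
      · rw [Set.disjoint_left] at hAB ⊢
        intro y hy hy'
        exact hAB hy hy'
    simp only [hs]
    apply Iadd
    · intro x; exact k0 _
    · intro x; exact k0 _
    · intro x; rw [← hs]; exact kle _
  · rintro ⟨g, h⟩ A
    have hs : ∀ x, k {y | (x, y) ∈ ((g, h) * ·) '' A} =
        (fun z => k {y | (z, y) ∈ A}) (Equiv.mulLeft g⁻¹ x) := by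
      intro x
      simp only [Equiv.coe_mulLeft]
      rw [← kinv h {y | (g⁻¹ * x, y) ∈ A}]
      congr 1
      ext y
      simp only [Set.mem_setOf_eq, Set.mem_image, Prod.exists, Prod.mk_mul_mk, Prod.mk.injEq]
      constructor
      · rintro ⟨a, b, hab, rfl, rfl⟩
        exact ⟨b, by simpa using hab, rfl⟩
      · rintro ⟨b, hb, rfl⟩
        exact ⟨_, b, hb, by simp, rfl⟩
    simp only [hs]
    refine Iinv (Equiv.mulLeft g⁻¹) ?_ (fun z => k {y | (z, y) ∈ A})
    intro B
    rw [← minv g⁻¹⁻¹ B]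
    congr 1
    ext y
    simp

theorem IsAmenable.surj_aux {G H : Type*} [Group G] [Group H] (hG : IsAmenable G)
    (f : G →* H) (hf : Function.Surjective f) : IsAmenable H := by
  obtain ⟨m, m0, m1, madd, minv⟩ := hG
  refine ⟨fun A => m (f ⁻¹' A), fun A => m0 _, by simpa using m1, ?_, ?_⟩
  · intro A B h
    simp only [Set.preimage_union]
    exact madd _ _ (h.preimage f)
  · intro h A
    obtain ⟨g, rfl⟩ := hf h
    simp only
    rw [← minv g (f ⁻¹' A)]
    congr 1
    ext y
    simp

theorem IsSofic.inj_aux {G H : Type*} [Group G] [Group H] (hH : IsSofic H)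
    (f : G →* H) (hf : Function.Injective f) : IsSofic G := by
  classical
  intro F ε hε
  obtain ⟨A, hA, hA', φ, h1, h2, h3⟩ := hH (F.image f) ε hε
  refine ⟨A, hA, hA', fun g => φ (f g), by simpa using h1, ?_, ?_⟩
  · intro g hg h hh
    simp only [map_mul]
    exact h2 _ (Finset.mem_image_of_mem _ hg) _ (Finset.mem_image_of_mem _ hh)
  · intro g hg hne
    exact h3 _ (Finset.mem_image_of_mem _ hg) (fun h => hne (hf (by simpa using h)))

theorem permDist_prod_le_aux {A B : Type*} [Finite A] [Finite B] [Nonempty A] [Nonempty B]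
    (σ σ' : Equiv.Perm A) (τ τ' : Equiv.Perm B) :
    permDist (σ.prodCongr τ : Equiv.Perm (A × B)) (σ'.prodCongr τ') ≤
      permDist σ σ' + permDist τ τ' := by
  have hA : (0:ℝ) < Nat.card A := by exact_mod_cast Nat.card_pos
  have hB : (0:ℝ) < Nat.card B := by exact_mod_cast Nat.card_pos
  unfold permDist
  rw [div_add_div _ _ hA.ne' hB.ne', Nat.card_prod, Nat.cast_mul]
  gcongr
  have hsub : {p : A × B | (σ.prodCongr τ : Equiv.Perm (A × B)) p ≠ (σ'.prodCongr τ') p} ⊆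
      ({a | σ a ≠ σ' a} ×ˢ Set.univ) ∪ (Set.univ ×ˢ {b | τ b ≠ τ' b}) := by
    rintro ⟨a, b⟩ h
    by_contra hc
    simp at hc h
    exact h hc.1 hc.2
  have := (Set.ncard_le_ncard hsub (Set.toFinite _)).trans (Set.ncard_union_le _ _)
  rw [Set.ncard_prod, Set.ncard_prod, Set.ncard_univ, Set.ncard_univ] at this
  exact_mod_cast this

theorem permDist_prod_left_aux {A B : Type*} [Finite A] [Finite B] [Nonempty A] [Nonempty B]
    (σ : Equiv.Perm A) (τ : Equiv.Perm B) :
    permDist σ 1 ≤ permDist (σ.prodCongr τ : Equiv.Perm (A × B)) 1 := by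
  have hA : (0:ℝ) < Nat.card A := by exact_mod_cast Nat.card_pos
  have hB : (0:ℝ) < Nat.card B := by exact_mod_cast Nat.card_pos
  unfold permDist
  rw [Nat.card_prod, Nat.cast_mul, ← mul_div_mul_right _ _ hB.ne']
  gcongr
  have hsub : ({a | σ a ≠ (1 : Equiv.Perm A) a} ×ˢ (Set.univ : Set B)) ⊆
      {p : A × B | (σ.prodCongr τ : Equiv.Perm (A × B)) p ≠ (1 : Equiv.Perm (A × B)) p} := by
    rintro ⟨a, b⟩ h hc
    simp at hc h
    exact h hc.1
  have := Set.ncard_le_ncard hsub (Set.toFinite _)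
  rw [Set.ncard_prod, Set.ncard_univ] at this
  exact_mod_cast this

theorem permDist_prod_right_aux {A B : Type*} [Finite A] [Finite B] [Nonempty A] [Nonempty B]
    (σ : Equiv.Perm A) (τ : Equiv.Perm B) :
    permDist τ 1 ≤ permDist (σ.prodCongr τ : Equiv.Perm (A × B)) 1 := by
  have hA : (0:ℝ) < Nat.card A := by exact_mod_cast Nat.card_pos
  have hB : (0:ℝ) < Nat.card B := by exact_mod_cast Nat.card_pos
  unfold permDist
  rw [Nat.card_prod, Nat.cast_mul, ← mul_div_mul_left _ _ hA.ne']
  gcongr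
  have hsub : ((Set.univ : Set A) ×ˢ {a | τ a ≠ (1 : Equiv.Perm B) a}) ⊆
      {p : A × B | (σ.prodCongr τ : Equiv.Perm (A × B)) p ≠ (1 : Equiv.Perm (A × B)) p} := by
    rintro ⟨a, b⟩ h hc
    simp at hc h
    exact h hc.2
  have := Set.ncard_le_ncard hsub (Set.toFinite _)
  rw [Set.ncard_prod, Set.ncard_univ] at this
  exact_mod_cast this

theorem IsSofic.prod_aux {G H : Type*} [Group G] [Group H] (hG : IsSofic G)
    (hH : IsSofic H) : IsSofic (G × H) := by
  classical
  intro F ε hε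
  obtain ⟨A, hA, hA', φ, h1, h2, h3⟩ := hG (F.image Prod.fst) (ε / 2) (by positivity)
  obtain ⟨B, hB, hB', ψ, k1, k2, k3⟩ := hH (F.image Prod.snd) (ε / 2) (by positivity)
  refine ⟨A × B, inferInstance, inferInstance, fun g => (φ g.1).prodCongr (ψ g.2), ?_, ?_, ?_⟩
  · ext ⟨a, b⟩ <;> simp [h1, k1]
  · intro g hg h hh
    have e : ((φ g.1).prodCongr (ψ g.2) : Equiv.Perm (A × B)) * (φ h.1).prodCongr (ψ h.2) =
        (φ g.1 * φ h.1).prodCongr (ψ g.2 * ψ h.2) := by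
      ext ⟨a, b⟩ <;> rfl
    simp only
    rw [e]
    have := permDist_prod_le_aux (φ (g * h).1) (φ g.1 * φ h.1) (ψ (g * h).2) (ψ g.2 * ψ h.2)
    have t1 := h2 _ (Finset.mem_image_of_mem _ hg) _ (Finset.mem_image_of_mem _ hh)
    have t2 := k2 _ (Finset.mem_image_of_mem _ hg) _ (Finset.mem_image_of_mem _ hh)
    rw [Prod.fst_mul, Prod.snd_mul] at *
    linarith
  · intro g hg hne
    by_cases hg1 : g.1 = 1
    · have hg2 : g.2 ≠ 1 := fun h => hne (Prod.ext hg1 h)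
      have := k3 _ (Finset.mem_image_of_mem _ hg) hg2
      have t := permDist_prod_right_aux (φ g.1) (ψ g.2)
      simp only
      linarith
    · have := h3 _ (Finset.mem_image_of_mem _ hg) hg1
      have t := permDist_prod_left_aux (φ g.1) (ψ g.2)
      simp only
      linarith

theorem IsSofic.quot_aux {P Q : Type*} [Group P] [Group Q] (hQ : IsSofic Q)
    (f : P →* Q) (N : Subgroup P) [N.Normal] (hN : f.ker = N) : IsSofic (P ⧸ N) := by
  subst hN
  exact hQ.inj_aux (QuotientGroup.kerLift f) (QuotientGroup.kerLift_injective f)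

theorem IsAmenable.quot_aux {P Q : Type*} [Group P] [Group Q] (hQ : IsAmenable Q)
    (f : P →* Q) (hf : Function.Surjective f) (N : Subgroup P) [N.Normal] (hN : f.ker = N) :
    IsAmenable (P ⧸ N) := by
  subst hN
  exact hQ.surj_aux (QuotientGroup.quotientKerEquivOfSurjective f hf).symm.toMonoidHom
    (MulEquiv.surjective _)

theorem CoSofic.prod_aux {P G₁ G₂ : Type*} [Group P] [Group G₁] [Group G₂]
    (e : P ≃* G₁ × G₂) (H₁ : Subgroup G₁) (H₂ : Subgroup G₂)
    (h₁ : CoSofic H₁) (h₂ : CoSofic H₂) : CoSofic ((H₁.prod H₂).comap e.toMonoidHom) := by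
  obtain ⟨w⟩ := h₁
  obtain ⟨v⟩ := h₂
  haveI := w.normal
  haveI := v.normal
  haveI hn : ∀ i, (((w.Hi i).prod (v.Hi i)).comap e.toMonoidHom).Normal := fun i => inferInstance
  refine ⟨{ Gi := fun i => ((w.Gi i).prod (v.Gi i)).comap e.toMonoidHom
            Hi := fun i => ((w.Hi i).prod (v.Hi i)).comap e.toMonoidHom
            antitone_G := fun i j h => Subgroup.comap_mono
              (Subgroup.prod_mono (w.antitone_G h) (v.antitone_G h))
            antitone_H := fun i j h => Subgroup.comap_mono
              (Subgroup.prod_mono (w.antitone_H h) (v.antitone_H h))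
            iInf_eq := ?_
            le := fun i => Subgroup.comap_mono (Subgroup.prod_mono (w.le i) (v.le i))
            normal := hn
            sofic := ?_
            amenable := ?_ }⟩
  · ext x
    have hw : ∀ y, y ∈ H₁ ↔ ∀ i, y ∈ w.Gi i := fun y => by
      rw [← Subgroup.mem_iInf, w.iInf_eq]
    have hv : ∀ y, y ∈ H₂ ↔ ∀ i, y ∈ v.Gi i := fun y => by
      rw [← Subgroup.mem_iInf, v.iInf_eq]
    simp only [Subgroup.mem_iInf, Subgroup.mem_comap, Subgroup.mem_prod, hw, hv]
    exact forall_and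
  · intro i
    refine ((w.sofic i).prod_aux (v.sofic i)).quot_aux
      (((QuotientGroup.mk' (w.Hi i)).prodMap (QuotientGroup.mk' (v.Hi i))).comp e.toMonoidHom) _ ?_
    ext x
    rw [MonoidHom.mem_ker, Prod.ext_iff]
    simp only [MonoidHom.comp_apply, MonoidHom.coe_prodMap, Prod.map_fst, Prod.map_snd,
      Prod.fst_one, Prod.snd_one, QuotientGroup.mk'_apply, QuotientGroup.eq_one_iff]
    rfl
  · intro i
    let Gp := ((w.Gi i).prod (v.Gi i)).comap e.toMonoidHom
    let p₁ : Gp →* w.Gi i :=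
      (((MonoidHom.fst G₁ G₂).comp e.toMonoidHom).comp Gp.subtype).codRestrict _ (fun x => x.2.1)
    let p₂ : Gp →* v.Gi i :=
      (((MonoidHom.snd G₁ G₂).comp e.toMonoidHom).comp Gp.subtype).codRestrict _ (fun x => x.2.2)
    refine ((w.amenable i).prod_aux (v.amenable i)).quot_aux
      (((QuotientGroup.mk' _).comp p₁).prod ((QuotientGroup.mk' _).comp p₂)) ?_ _ ?_
    · rintro ⟨a, b⟩
      obtain ⟨a, rfl⟩ := QuotientGroup.mk'_surjective _ a
      obtain ⟨b, rfl⟩ := QuotientGroup.mk'_surjective _ b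
      have hx : e (e.symm (a.1, b.1)) = (a.1, b.1) := e.apply_symm_apply _
      refine ⟨⟨e.symm (a.1, b.1), ?_⟩, ?_⟩
      · change e (e.symm (a.1, b.1)) ∈ (w.Gi i).prod (v.Gi i)
        rw [hx]
        exact ⟨a.2, b.2⟩
      · refine Prod.ext ?_ ?_
        · refine congrArg (QuotientGroup.mk' _) (Subtype.ext ?_)
          exact congrArg Prod.fst hx
        · refine congrArg (QuotientGroup.mk' _) (Subtype.ext ?_)
          exact congrArg Prod.snd hx
    · ext x
      rw [MonoidHom.mem_ker, Prod.ext_iff]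
      simp only [MonoidHom.prod_apply, MonoidHom.comp_apply, Prod.fst_one, Prod.snd_one,
        QuotientGroup.mk'_apply, QuotientGroup.eq_one_iff]
      rfl

/-- σ-co-soficity is preserved under direct products. -/
theorem sigmaCoSofic_prod {G₁ G₂ : Type*} [Group G₁] [Group G₂]
    (H₁ : Subgroup G₁) (H₂ : Subgroup G₂)
    (h₁ : SigmaCoSofic H₁) (h₂ : SigmaCoSofic H₂) :
    SigmaCoSofic (H₁.prod H₂) := by
  obtain ⟨A, B, hA, hB, sA, sB, hBA, cA⟩ := h₁
  obtain ⟨C, D, hC, hD, sC, sD, hDC, cC⟩ := h₂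
  have key : ∀ (U : ℕ → Subgroup G₁) (V : ℕ → Subgroup G₂), Monotone U → Monotone V →
      (⨆ i, (U i).prod (V i)) = (⨆ i, U i).prod (⨆ i, V i) := by
    intro U V hU hV
    have hUV : Monotone (fun i => (U i).prod (V i)) := fun i j h =>
      Subgroup.prod_mono (hU h) (hV h)
    ext ⟨x, y⟩
    rw [Subgroup.mem_iSup_of_directed hUV.directed_le, Subgroup.mem_prod,
      Subgroup.mem_iSup_of_directed hU.directed_le, Subgroup.mem_iSup_of_directed hV.directed_le]
    constructor
    · rintro ⟨i, h⟩
      exact ⟨⟨i, h.1⟩, ⟨i, h.2⟩⟩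
    · rintro ⟨⟨i, h⟩, ⟨j, h'⟩⟩
      exact ⟨max i j, hU (le_max_left i j) h, hV (le_max_right i j) h'⟩
  refine ⟨fun i => (A i).prod (C i), fun i => (B i).prod (D i),
    fun i j h => Subgroup.prod_mono (hA h) (hC h), fun i j h => Subgroup.prod_mono (hB h) (hD h),
    ?_, ?_, fun i => Subgroup.prod_mono (hBA i) (hDC i), ?_⟩
  · rw [key A C hA hC, sA, sC, Subgroup.top_prod_top]
  · rw [key B D hB hD, sB, sD]
  · intro i
    exact CoSofic.prod_aux (Subgroup.prodEquiv (A i) (C i)) _ _ (cA i) (cC i)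
end

section
/- Let H be a subgroup of a group G and suppose H is co-sofic in G. Then H < G is relatively sofic over G itself. -/
universe u v

/-- The subgroup of sequences equal to the identity ω-almost everywhere. -/
def upKer {ι : Type*} (ω : Ultrafilter ι) (G : ι → Type*) [∀ i, Group (G i)] :
    Subgroup (∀ i, G i) where
  carrier := {f | ∀ᶠ i in (ω : Filter ι), f i = 1}
  one_mem' := Filter.Eventually.of_forall fun _ => rfl
  mul_mem' := by
    intro a b ha hb
    filter_upwards [ha, hb] with i h1 h2
    simp [h1, h2]
  inv_mem' := by
    intro a ha
    filter_upwards [ha] with i h1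
    simp [h1]

instance upKer_normal {ι : Type*} (ω : Ultrafilter ι) (G : ι → Type*) [∀ i, Group (G i)] :
    (upKer ω G).Normal := by
  constructor
  intro a ha g
  filter_upwards [ha] with i h1
  simp [h1]

/-- The algebraic ultraproduct of a family of groups along an ultrafilter. -/
def Ultraproduct {ι : Type*} (ω : Ultrafilter ι) (G : ι → Type*) [∀ i, Group (G i)] :=
  (∀ i, G i) ⧸ upKer ω G

instance {ι : Type*} (ω : Ultrafilter ι) (G : ι → Type*) [∀ i, Group (G i)] :
    Group (Ultraproduct ω G) :=
  QuotientGroup.Quotient.group _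

/-- The subgroup `∏_ω H_i` of the algebraic ultraproduct `∏_ω G_i`. -/
def upSubgroup {ι : Type*} (ω : Ultrafilter ι) {G : ι → Type*} [∀ i, Group (G i)]
    (H : ∀ i, Subgroup (G i)) : Subgroup (Ultraproduct ω G) :=
  Subgroup.map (QuotientGroup.mk' (upKer ω G)) (Subgroup.pi Set.univ H)


/-- A witness to relative soficity of `H < G` over `K`. -/
structure RelSoficWitness {G : Type*} [Group G] (H : Subgroup G) (K : Type*) [Group K] where
  Gi : ℕ → Type u
  [instGi : ∀ i, Group (Gi i)]
  Hi : ∀ i, Subgroup (Gi i)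
  ω : Ultrafilter ℕ
  free : ∀ s : Set ℕ, s.Finite → s ∉ ω
  sofic : ∀ i, IsSofic (Gi i)
  amenable : ∀ i, IsAmenable (Hi i)
  π : G →* Ultraproduct ω (fun i => Gi i × K)
  inj : Function.Injective π
  inter : Subgroup.map π ⊤ ⊓ upSubgroup ω (fun i => (Hi i).prod ⊤) = Subgroup.map π H

/-- `H < G` is relatively sofic over `K`. -/
def RelativelySofic {G : Type*} [Group G] (H : Subgroup G) (K : Type*) [Group K] : Prop :=
  Nonempty (RelSoficWitness.{u} H K)


theorem isAmenable_of_surjective {A B : Type*} [Group A] [Group B] (f : A →* B)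
    (hf : Function.Surjective f) (h : IsAmenable A) : IsAmenable B := by
  obtain ⟨m, h0, h1, hadd, hinv⟩ := h
  refine ⟨fun S => m (f ⁻¹' S), fun S => h0 _, by simpa using h1, ?_, ?_⟩
  · intro S T hST
    exact hadd _ _ (hST.preimage f)
  · intro g S
    obtain ⟨a, rfl⟩ := hf g
    change m (f ⁻¹' _) = m (f ⁻¹' S)
    rw [← hinv a (f ⁻¹' S)]
    congr 1
    ext x
    simp only [Set.mem_preimage, Set.mem_image]
    constructor
    · rintro ⟨s, hs, hx⟩
      refine ⟨a⁻¹ * x, ?_, by simp⟩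
      rw [map_mul, ← hx, map_inv]
      simpa using hs
    · rintro ⟨y, hy, rfl⟩
      exact ⟨f y, hy, by simp⟩

/-- If `H` is co-sofic in `G`, then `H < G` is relatively sofic over `G` itself. -/
theorem relativelySofic_of_coSofic {G : Type u} [Group G] (H : Subgroup G)
    (h : CoSofic H) :
    RelativelySofic.{u} H G := by
  obtain ⟨w⟩ := h
  haveI := w.normal
  have hfree : ∀ s : Set ℕ, s.Finite → s ∉ Filter.hyperfilter ℕ :=
    fun s hs => Filter.notMem_hyperfilter_of_finite hs
  let D : G →* (∀ i, (G ⧸ w.Hi i) × G) :=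
    MonoidHom.mk' (fun g i => (QuotientGroup.mk g, g)) (fun a b => rfl)
  let P : G →* Ultraproduct (Filter.hyperfilter ℕ) (fun i => (G ⧸ w.Hi i) × G) :=
    (QuotientGroup.mk' (upKer (Filter.hyperfilter ℕ) (fun i => (G ⧸ w.Hi i) × G))).comp D
  refine ⟨{ Gi := fun i => G ⧸ w.Hi i
            Hi := fun i => (w.Gi i).map (QuotientGroup.mk' (w.Hi i))
            ω := Filter.hyperfilter ℕ
            free := hfree
            sofic := w.sofic
            amenable := ?_
            π := P
            inj := ?_
            inter := ?_ }⟩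
  · intro i
    let r : w.Gi i →* (w.Gi i).map (QuotientGroup.mk' (w.Hi i)) :=
      (QuotientGroup.mk' (w.Hi i)).subgroupMap (w.Gi i)
    refine isAmenable_of_surjective
      (QuotientGroup.lift ((w.Hi i).subgroupOf (w.Gi i)) r ?_) ?_ (w.amenable i)
    · intro x hx
      apply Subtype.ext
      exact (QuotientGroup.eq_one_iff (x : G)).2 hx
    · intro y
      obtain ⟨x, rfl⟩ := (QuotientGroup.mk' (w.Hi i)).subgroupMap_surjective (w.Gi i) y
      exact ⟨QuotientGroup.mk x, rfl⟩
  · rw [injective_iff_map_eq_one]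
    intro g hg
    have h2 : D g ∈ upKer (Filter.hyperfilter ℕ) (fun i => (G ⧸ w.Hi i) × G) :=
      (QuotientGroup.eq_one_iff (D g)).1 hg
    have h3 : ∀ᶠ i in (Filter.hyperfilter ℕ : Filter ℕ), D g i = 1 := h2
    obtain ⟨i, hi⟩ := h3.exists
    exact congrArg Prod.snd hi
  · ext x
    constructor
    · rintro ⟨⟨g, -, rfl⟩, ⟨f, hf, hfg⟩⟩
      refine ⟨g, ?_, rfl⟩
      have h2 : f⁻¹ * D g ∈ upKer (Filter.hyperfilter ℕ) (fun i => (G ⧸ w.Hi i) × G) :=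
        QuotientGroup.eq.1 hfg
      have h3 : ∀ᶠ i in (Filter.hyperfilter ℕ : Filter ℕ), (f⁻¹ * D g) i = 1 := h2
      have key : ∀ᶠ i in (Filter.hyperfilter ℕ : Filter ℕ), g ∈ w.Gi i := by
        filter_upwards [h3] with i hi
        have e : f i = D g i := inv_mul_eq_one.1 hi
        have hm := (hf i (Set.mem_univ i)).1
        rw [e] at hm
        obtain ⟨k, hk, hkg⟩ := hm
        have : k⁻¹ * g ∈ w.Hi i := QuotientGroup.eq.1 hkg
        simpa using (w.Gi i).mul_mem hk (w.le i this)
      rw [← w.iInf_eq]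
      simp only [SetLike.mem_coe, Subgroup.mem_iInf]
      intro j
      by_contra hj
      refine hfree {i | g ∈ w.Gi i} ((Set.finite_lt_nat j).subset ?_) key
      intro i hi
      by_contra hij
      exact hj (w.antitone_G (not_lt.1 hij) hi)
    · rintro ⟨g, hg, rfl⟩
      refine ⟨⟨g, trivial, rfl⟩, ⟨D g, ?_, rfl⟩⟩
      intro i _
      refine ⟨⟨g, ?_, rfl⟩, trivial⟩
      have hg' : g ∈ ⨅ i, w.Gi i := by rw [w.iInf_eq]; exact hg
      exact Subgroup.mem_iInf.1 hg' i
end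

section
/- Let H < G be a pair of groups, and let (G_k)_{k∈ℕ} and (H_k)_{k∈ℕ} be two increasing sequences of subgroups of G with ∪_k G_k = G, ∪_k H_k = H, and H_k ≤ G_k for all k. Suppose H_k < G_k is relatively sofic over a fixed group K for all k. Then H < G is relatively sofic over K. -/
universe u v

theorem up_mk_eq {ι : Type*} (ω : Ultrafilter ι) {G : ι → Type*} [∀ i, Group (G i)]
    (f g : ∀ i, G i) :
    QuotientGroup.mk' (upKer ω G) f = QuotientGroup.mk' (upKer ω G) g ↔
      ∀ᶠ i in (ω : Filter ι), f i = g i := by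
  rw [QuotientGroup.mk'_apply, QuotientGroup.mk'_apply, QuotientGroup.eq]
  change (∀ᶠ i in (ω : Filter ι), (f⁻¹ * g) i = 1) ↔ _
  simp only [Pi.mul_apply, Pi.inv_apply, inv_mul_eq_one]

theorem up_mk_mem {ι : Type*} (ω : Ultrafilter ι) {G : ι → Type*} [∀ i, Group (G i)]
    (H : ∀ i, Subgroup (G i)) (f : ∀ i, G i) :
    QuotientGroup.mk' (upKer ω G) f ∈ Subgroup.map (QuotientGroup.mk' (upKer ω G))
      (Subgroup.pi Set.univ H) ↔ ∀ᶠ i in (ω : Filter ι), f i ∈ H i := by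
  classical
  rw [Subgroup.mem_map]
  constructor
  · rintro ⟨g, hg, hgf⟩
    rw [up_mk_eq] at hgf
    filter_upwards [hgf] with i hi
    rw [← hi]
    exact hg i (Set.mem_univ i)
  · intro hf
    refine ⟨fun i => if f i ∈ H i then f i else 1, ?_, ?_⟩
    · intro i _
      change (if f i ∈ H i then f i else 1) ∈ H i
      split_ifs with h
      · exact h
      · exact one_mem _
    · rw [up_mk_eq]
      filter_upwards [hf] with i hi
      simp [hi]

/-- Fubini-type ultrafilter. -/
noncomputable def fubU (w : ℕ → Ultrafilter ℕ) : Ultrafilter ℕ :=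
  Ultrafilter.bind (Filter.hyperfilter ℕ) (fun k => (w k).map (fun i => Nat.pair k i))

theorem fubU_ev (w : ℕ → Ultrafilter ℕ) (P : ℕ → Prop) :
    (∀ᶠ n in (fubU w : Filter ℕ), P n) ↔
      ∀ᶠ k in (Filter.hyperfilter ℕ : Filter ℕ), ∀ᶠ i in (w k : Filter ℕ), P (Nat.pair k i) :=
  Iff.rfl

theorem fubU_ev2 (w : ℕ → Ultrafilter ℕ) (Q : ℕ → ℕ → Prop) :
    (∀ᶠ n in (fubU w : Filter ℕ), Q n.unpair.1 n.unpair.2) ↔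
      ∀ᶠ k in (Filter.hyperfilter ℕ : Filter ℕ), ∀ᶠ i in (w k : Filter ℕ), Q k i := by
  rw [fubU_ev]
  simp only [Nat.unpair_pair]

theorem ev_hyper {P : ℕ → Prop} (k0 : ℕ) (h : ∀ k, k0 ≤ k → P k) :
    ∀ᶠ k in (Filter.hyperfilter ℕ : Filter ℕ), P k := by
  have : ∀ᶠ k in Filter.atTop, P k := Filter.eventually_atTop.2 ⟨k0, h⟩
  exact Nat.hyperfilter_le_atTop this

/-- data extracted from a witness -/
theorem witness_lift {G : Type*} [Group G] {H : Subgroup G} {K : Type*} [Group K]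
    (W : RelSoficWitness.{u} H K) :
    letI := W.instGi
    ∃ f : G → ∀ i, W.Gi i × K,
      (∀ g h, ∀ᶠ i in (W.ω : Filter ℕ), f (g * h) i = f g i * f h i) ∧
      (∀ g, (∀ᶠ i in (W.ω : Filter ℕ), f g i = 1) → g = 1) ∧
      (∀ g, (∀ᶠ i in (W.ω : Filter ℕ), f g i ∈ (W.Hi i).prod (⊤ : Subgroup K)) ↔ g ∈ H) := by
  letI := W.instGi
  have hs : ∀ g, ∃ f : ∀ i, W.Gi i × K, QuotientGroup.mk' (upKer W.ω _) f = W.π g :=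
    fun g => QuotientGroup.mk'_surjective _ _
  choose f hf using hs
  refine ⟨f, ?_, ?_, ?_⟩
  · intro g h
    refine (up_mk_eq W.ω (f (g * h)) (f g * f h)).1 ?_
    rw [map_mul, hf, hf, hf, map_mul]
    rfl
  · intro g hg
    have := (up_mk_eq W.ω (f g) 1).2 hg
    rw [hf, map_one] at this
    exact W.inj (this.trans (map_one W.π).symm)
  · intro g
    rw [← up_mk_mem W.ω (fun i => (W.Hi i).prod (⊤ : Subgroup K)) (f g), hf]
    have hi := W.inter
    constructor
    · intro hm
      have : W.π g ∈ Subgroup.map W.π H := by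
        rw [← hi]
        exact ⟨⟨g, trivial, rfl⟩, hm⟩
      obtain ⟨g', hg', e⟩ := this
      rwa [← W.inj e]
    · intro hg
      have : W.π g ∈ Subgroup.map W.π H := ⟨g, hg, rfl⟩
      rw [← hi] at this
      exact this.2

/-- If `H < G` is an increasing union of pairs `H_k < G_k` each relatively sofic
over a fixed group `K`, then `H < G` is relatively sofic over `K`. -/
theorem relativelySofic_of_increasing_union {G : Type*} [Group G]
    {K : Type*} [Group K] (H : Subgroup G) (Gk Hk : ℕ → Subgroup G)
    (hGmono : Monotone Gk) (hHmono : Monotone Hk)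
    (hGsup : (⨆ k, Gk k) = ⊤) (hHsup : (⨆ k, Hk k) = H)
    (hle : ∀ k, Hk k ≤ Gk k)
    (h : ∀ k, RelativelySofic.{u} ((Hk k).subgroupOf (Gk k)) K) :
    RelativelySofic.{u} H K := by
  classical
  have W : ∀ k, RelSoficWitness.{u} ((Hk k).subgroupOf (Gk k)) K := fun k => (h k).some
  letI inst : ∀ k i, Group ((W k).Gi i) := fun k => (W k).instGi
  choose f hmul hone hmem using fun k => witness_lift (W k)
  let F : G → ∀ k i, (W k).Gi i × K := fun g k i =>
    if hg : g ∈ Gk k then f k ⟨g, hg⟩ i else 1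
  have hF : ∀ g k (hg : g ∈ Gk k) i, F g k i = f k ⟨g, hg⟩ i := fun g k hg i => dif_pos hg
  have hex : ∀ g, ∃ k0, ∀ k, k0 ≤ k → g ∈ Gk k := by
    intro g
    have : g ∈ ⨆ k, Gk k := by rw [hGsup]; trivial
    obtain ⟨k0, hk0⟩ := (Subgroup.mem_iSup_of_directed hGmono.directed_le).1 this
    exact ⟨k0, fun k hk => hGmono hk hk0⟩
  have hev : ∀ g, ∀ᶠ k in (Filter.hyperfilter ℕ : Filter ℕ), g ∈ Gk k := by
    intro g
    obtain ⟨k0, hk⟩ := hex g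
    exact ev_hyper k0 hk
  let ω : Ultrafilter ℕ := fubU fun k => (W k).ω
  let GG : ℕ → Type u := fun n => (W n.unpair.1).Gi n.unpair.2
  letI instGG : ∀ n, Group (GG n) := fun n => inst n.unpair.1 n.unpair.2
  let HH : ∀ n, Subgroup (GG n) := fun n => (W n.unpair.1).Hi n.unpair.2
  let L : G → ∀ n, GG n × K := fun g n => F g n.unpair.1 n.unpair.2
  let π : G →* Ultraproduct ω (fun n => GG n × K) :=
    MonoidHom.mk' (fun g => QuotientGroup.mk' (upKer ω (fun n => GG n × K)) (L g)) (by
      intro a b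
      refine Eq.trans ?_ (map_mul (QuotientGroup.mk' (upKer ω (fun n => GG n × K))) (L a) (L b))
      refine (up_mk_eq ω (L (a * b)) (L a * L b)).2 ?_
      refine (fubU_ev2 (fun k => (W k).ω) (fun k i => F (a * b) k i = F a k i * F b k i)).2 ?_
      filter_upwards [hev a, hev b] with k ha hb
      filter_upwards [hmul k ⟨a, ha⟩ ⟨b, hb⟩] with i hi
      rw [hF _ _ ha, hF _ _ hb, hF _ _ (mul_mem ha hb)]
      exact hi)
  have hπ : ∀ g, (π g ∈ upSubgroup ω (fun n => (HH n).prod (⊤ : Subgroup K))) ↔ g ∈ H := by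
    intro g
    refine (up_mk_mem ω (fun n => (HH n).prod (⊤ : Subgroup K)) (L g)).trans ?_
    refine (fubU_ev2 (fun k => (W k).ω)
      (fun k i => F g k i ∈ ((W k).Hi i).prod (⊤ : Subgroup K))).trans ?_
    rw [← hHsup, Subgroup.mem_iSup_of_directed hHmono.directed_le]
    constructor
    · intro hg
      obtain ⟨k, h1, h2⟩ := (hg.and (hev g)).exists
      refine ⟨k, ?_⟩
      simp only [hF g k h2] at h1
      exact Subgroup.mem_subgroupOf.1 ((hmem k ⟨g, h2⟩).1 h1)
    · rintro ⟨k0, hk0⟩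
      refine ev_hyper k0 fun k hk => ?_
      have h1 : g ∈ Hk k := hHmono hk hk0
      have h2 := hle k h1
      simp only [hF g k h2]
      exact (hmem k ⟨g, h2⟩).2 (Subgroup.mem_subgroupOf.2 h1)
  refine ⟨@RelSoficWitness.mk _ _ _ _ _ GG instGG HH ω ?_ ?_ ?_ π ?_ ?_⟩
  · intro s hs hmem
    have h1 : ∀ᶠ n in (fubU fun k => (W k).ω : Filter ℕ), n ∈ s := hmem
    rw [fubU_ev] at h1
    obtain ⟨k, hk⟩ := h1.exists
    refine (W k).free {i | Nat.pair k i ∈ s} ?_ hk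
    refine hs.preimage (Function.Injective.injOn ?_)
    intro a b hab
    exact (Nat.pair_eq_pair.1 hab).2
  · exact fun n => (W n.unpair.1).sofic n.unpair.2
  · exact fun n => (W n.unpair.1).amenable n.unpair.2
  · rw [injective_iff_map_eq_one]
    intro g hg
    have h1 := (up_mk_eq ω (L g) 1).1 (Eq.trans hg (map_one (QuotientGroup.mk' _)).symm)
    have h2 := (fubU_ev2 (fun k => (W k).ω) (fun k i => F g k i = 1)).1 h1
    obtain ⟨k, h3, h4⟩ := (h2.and (hev g)).exists
    simp only [hF g k h4] at h3
    exact congrArg Subtype.val (hone k ⟨g, h4⟩ h3)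
  · ext x
    constructor
    · rintro ⟨⟨g, -, rfl⟩, hx⟩
      exact ⟨g, (hπ g).1 hx, rfl⟩
    · rintro ⟨g, hg, rfl⟩
      exact ⟨⟨g, trivial, rfl⟩, (hπ g).2 hg⟩
end

section
/- Let G be a countable sofic group and H a σ-co-sofic subgroup of G. Then the amalgamated free product ∗_H G of countably infinitely many copies of G amalgamated over H (each copy of H identified via the same inclusion H ↪ G) is sofic. -/
universe u v

/-! ### Fractions -/

noncomputable def frac {A : Type*} (p : A → Prop) : ℝ :=
  (Set.ncard {a | p a} : ℝ) / (Nat.card A : ℝ)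

lemma permDist_eq_frac {A : Type*} (σ τ : Equiv.Perm A) :
    permDist σ τ = frac (fun a => σ a ≠ τ a) := rfl

lemma frac_nonneg {A : Type*} (p : A → Prop) : 0 ≤ frac p := by
  unfold frac; positivity

lemma frac_mono {A : Type*} [Finite A] {p q : A → Prop} (h : ∀ a, p a → q a) :
    frac p ≤ frac q := by
  unfold frac
  gcongr
  · exact Set.toFinite _
  · exact h _

lemma frac_or_le {A : Type*} [Finite A] (p q : A → Prop) :
    frac (fun a => p a ∨ q a) ≤ frac p + frac q := by
  unfold frac
  rw [← add_div]
  gcongr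
  exact_mod_cast Set.ncard_union_le {a | p a} {a | q a}

lemma frac_false {A : Type*} : frac (fun _ : A => False) = 0 := by
  simp [frac]

lemma frac_true {A : Type*} [Finite A] [Nonempty A] : frac (fun _ : A => True) = 1 := by
  have : (Nat.card A : ℝ) ≠ 0 := by exact_mod_cast Nat.card_pos.ne'
  simp [frac, Set.ncard_univ, this]

lemma frac_le_one {A : Type*} [Finite A] [Nonempty A] (p : A → Prop) : frac p ≤ 1 := by
  rw [← frac_true (A := A)]
  exact frac_mono fun _ _ => trivial

lemma frac_not {A : Type*} [Finite A] [Nonempty A] (p : A → Prop) :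
    frac (fun a => ¬ p a) = 1 - frac p := by
  have h0 : (Nat.card A : ℝ) ≠ 0 := by exact_mod_cast Nat.card_pos.ne'
  have h := Set.ncard_add_ncard_compl {a | p a}
  unfold frac
  rw [eq_sub_iff_add_eq, ← add_div, div_eq_one_iff_eq h0, add_comm]
  exact_mod_cast h

lemma frac_exists_le {A ι : Type*} [Finite A] (s : Finset ι) (p : ι → A → Prop) :
    frac (fun a => ∃ j ∈ s, p j a) ≤ ∑ j ∈ s, frac (p j) := by
  classical
  induction s using Finset.induction_on with
  | empty => simp [frac_false]
  | insert i s hi ih =>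
    rw [Finset.sum_insert hi]
    refine le_trans (frac_mono (q := fun a => p i a ∨ ∃ j ∈ s, p j a) ?_)
      ((frac_or_le _ _).trans (by gcongr))
    intro a
    simp

lemma frac_exists_le_mul {A ι : Type*} [Finite A] (s : Finset ι) (p : ι → A → Prop) (δ : ℝ)
    (h : ∀ j ∈ s, frac (p j) ≤ δ) :
    frac (fun a => ∃ j ∈ s, p j a) ≤ s.card * δ := by
  refine (frac_exists_le s p).trans ((Finset.sum_le_sum h).trans ?_)
  simp

lemma frac_equiv {A B : Type*} (e : A ≃ B) (p : B → Prop) :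
    frac (fun a => p (e a)) = frac p := by
  unfold frac
  rw [Nat.card_congr e]
  congr 2
  have : {a | p a} = e '' {a | p (e a)} := by
    ext b; constructor
    · intro h; exact ⟨e.symm b, by simpa using h, by simp⟩
    · rintro ⟨a, ha, rfl⟩; exact ha
  rw [this, Set.ncard_image_of_injective _ e.injective]

lemma frac_prod {A C : Type*} [Finite A] [Fintype A] [Finite C] (p : A → C → Prop) :
    frac (fun x : A × C => p x.1 x.2) = (∑ a, frac (p a)) / Nat.card A := by
  classical
  have := Fintype.ofFinite C
  unfold frac
  rw [Nat.card_prod, ← Finset.sum_div, div_div, mul_comm, Nat.cast_mul]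
  congr 1
  · rw [← Nat.cast_sum]
    congr 1
    have : ∀ a, Set.ncard {c | p a c} = (Finset.univ.filter (p a)).card := by
      intro a
      rw [← Set.ncard_coe_finset]; congr 1; ext; simp
    simp only [this]
    rw [← Finset.card_sigma, ← Set.ncard_coe_finset]
    refine Set.ncard_congr (fun x _ => ⟨x.1, x.2⟩) ?_ ?_ ?_
    · intro a ha; simpa using ha
    · rintro ⟨a, b⟩ ⟨c, d⟩ _ _ h
      simp only [Sigma.mk.injEq] at h
      obtain ⟨h1, h2⟩ := h
      simp at h2; simp [h1, h2]
    · rintro ⟨a, c⟩ h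
      exact ⟨(a, c), by simpa using h, rfl⟩

lemma frac_prod_fst {A C : Type*} [Finite A] [Finite C] [Nonempty C] (p : A → Prop) :
    frac (fun x : A × C => p x.1) = frac p := by
  classical
  have := Fintype.ofFinite A
  rw [frac_prod (fun a (_ : C) => p a)]
  conv_rhs => unfold frac
  congr 1
  have : ∀ a, frac (fun _ : C => p a) = if p a then 1 else 0 := by
    intro a
    by_cases h : p a
    · simp [h, frac_true]
    · simp [h, frac_false]
  simp only [this]
  rw [Finset.sum_boole, ← Set.ncard_coe_finset]
  congr 2; ext; simp

lemma frac_prod_le {A C : Type*} [Finite A] [Nonempty A] [Finite C] (p : A → C → Prop) (δ : ℝ)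
    (h : ∀ a, frac (p a) ≤ δ) : frac (fun x : A × C => p x.1 x.2) ≤ δ := by
  have := Fintype.ofFinite A
  have h0 : (0 : ℝ) < Nat.card A := by exact_mod_cast Nat.card_pos
  rw [frac_prod, div_le_iff₀ h0]
  refine (Finset.sum_le_sum fun a _ => h a).trans ?_
  simp [mul_comm]

lemma frac_prod_snd {A C : Type*} [Finite A] [Finite C] [Nonempty A] (p : C → Prop) :
    frac (fun x : A × C => p x.2) = frac p := by
  rw [← frac_prod_fst (C := A) p, ← frac_equiv (Equiv.prodComm A C)]
  rfl

/-! ### Folner sets -/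

lemma IsAmenable.doubling {K : Type*} [Group K] [DecidableEq K] (hK : IsAmenable K)
    (E : Finset K) :
    ∃ T : Finset K, (E.biUnion fun k => T.image (k * ·)).card < 2 * T.card := by
  obtain ⟨m, hm0, hm1, hmadd, hminv⟩ := hK
  by_contra! hcon
  -- Hall
  have hall := (Finset.all_card_le_biUnion_card_iff_exists_injective
    (fun x : K × Bool => E.image (· * x.1))).1 ?_
  · obtain ⟨f, hfinj, hf⟩ := hall
    have hk : ∀ x : K × Bool, f x * x.1⁻¹ ∈ E := by
      intro x
      have := hf x
      simp only [Finset.mem_image] at this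
      obtain ⟨k, hk, hkx⟩ := this
      rw [← hkx]; simpa using hk
    have mempty : m ∅ = 0 := by
      have := hmadd ∅ ∅ (by simp)
      simp at this; linarith
    -- finite additivity
    have madd : ∀ {ι : Type _} (s : Finset ι) (A : ι → Set K),
        (∀ i ∈ s, ∀ j ∈ s, i ≠ j → Disjoint (A i) (A j)) →
        m (⋃ i ∈ s, A i) = ∑ i ∈ s, m (A i) := by
      intro ι s A hA
      classical
      induction s using Finset.induction_on with
      | empty => simp [mempty]
      | insert i s hi ih =>
        rw [Finset.sum_insert hi, Finset.set_biUnion_insert, hmadd, ih]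
        · intro a ha b hb; exact hA a (by simp [ha]) b (by simp [hb])
        · rw [Set.disjoint_iUnion₂_right]
          intro j hj
          exact hA i (by simp) j (by simp [hj]) (by rintro rfl; exact hi hj)
    let A : K × Bool → Set K := fun kb => {x | f (x, kb.2) * x⁻¹ = kb.1}
    have hsum : ∀ b, ∑ k ∈ E, m (A (k, b)) = 1 := by
      intro b
      rw [← madd E (fun k => A (k, b)), ← hm1]
      · congr 1
        ext x
        simpa [A] using hk (x, b)
      · intro i _ j _ hij
        rw [Set.disjoint_left]
        intro x hx hx'
        exact hij (hx.symm.trans hx')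
    have h2 : ∑ kb ∈ E ×ˢ (Finset.univ : Finset Bool), m ((kb.1 * ·) '' A kb) ≤ 1 := by
      rw [← madd]
      · have := hmadd (⋃ kb ∈ E ×ˢ (Finset.univ : Finset Bool), (kb.1 * ·) '' A kb)
          (⋃ kb ∈ E ×ˢ (Finset.univ : Finset Bool), (kb.1 * ·) '' A kb)ᶜ disjoint_compl_right
        rw [Set.union_compl_self, hm1] at this
        linarith [hm0 (⋃ kb ∈ E ×ˢ (Finset.univ : Finset Bool), (kb.1 * ·) '' A kb)ᶜ]
      · rintro ⟨k, b⟩ _ ⟨k', b'⟩ _ hne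
        rw [Set.disjoint_left]
        rintro y ⟨x, hx, rfl⟩ ⟨x', hx', h⟩
        simp only [A, Set.mem_ofPred_eq] at hx hx'
        have e1 : k * x = f (x, b) := by rw [← hx]; simp
        have e2 : k' * x' = f (x', b') := by rw [← hx']; simp
        have h3 : f (x', b') = f (x, b) := by rw [← e1, ← e2]; exact h
        have h4 := hfinj h3
        simp only [Prod.mk.injEq] at h4
        obtain ⟨rfl, rfl⟩ := h4
        exact hne (by rw [← hx, ← hx'])
    simp only [hminv] at h2
    rw [Finset.sum_product_right] at h2
    simp [hsum] at h2
  · intro s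
    have h1 := hcon (s.image Prod.fst)
    have h2 : s.card ≤ 2 * (s.image Prod.fst).card := by
      have : s ⊆ (s.image Prod.fst) ×ˢ (Finset.univ : Finset Bool) := by
        rintro ⟨a, b⟩ h
        simp only [Finset.mem_product, Finset.mem_image, Finset.mem_univ, and_true]
        exact ⟨_, h, rfl⟩
      have := Finset.card_le_card this
      rw [Finset.card_product] at this
      simpa [mul_comm] using this
    refine h2.trans (h1.trans (Finset.card_le_card ?_))
    intro y
    simp only [Finset.mem_biUnion, Finset.mem_image]
    rintro ⟨k, hk, x, ⟨z, hz, rfl⟩, rfl⟩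
    exact ⟨z, hz, k, hk, rfl⟩

open Pointwise in
lemma IsAmenable.folner_left {K : Type*} [Group K] [DecidableEq K] (hK : IsAmenable K)
    (E : Finset K) (δ : ℝ) (hδ : 0 < δ) :
    ∃ T : Finset K, T.Nonempty ∧ ((E * T).card : ℝ) < (1 + δ) * T.card := by
  by_contra! hcon
  have hpow : ∀ (n : ℕ) (T : Finset K), T.Nonempty →
      (1 + δ) ^ n * (T.card : ℝ) ≤ ((E ^ n * T).card : ℝ) := by
    intro n
    induction n with
    | zero => intro T _; simp
    | succ n ih =>
      intro T hT
      have h1 := ih T hT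
      have hne : (E ^ n * T).Nonempty := by
        rw [← Finset.card_pos]
        have : (0 : ℝ) < T.card := by exact_mod_cast hT.card_pos
        have : (0 : ℝ) < ((E ^ n * T).card : ℝ) := lt_of_lt_of_le (by positivity) h1
        exact_mod_cast this
      have h2 := hcon _ hne
      rw [pow_succ' E, mul_assoc]
      refine le_trans ?_ h2
      rw [pow_succ' (1 + δ), mul_assoc]
      gcongr
  obtain ⟨n, hn⟩ := pow_unbounded_of_one_lt (2 : ℝ) (show 1 < 1 + δ by linarith)
  obtain ⟨T, hT⟩ := hK.doubling (E ^ n)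
  have hTne : T.Nonempty := by
    rw [Finset.nonempty_iff_ne_empty]
    rintro rfl
    simp at hT
  have h1 := hpow n T hTne
  have e : (E ^ n).biUnion (fun k => T.image (k * ·)) = E ^ n * T := by
    ext y; simp only [Finset.mem_biUnion, Finset.mem_image, Finset.mem_mul]
  rw [e] at hT
  have hT' : ((E ^ n * T).card : ℝ) < 2 * T.card := by exact_mod_cast hT
  have : (0 : ℝ) < T.card := by exact_mod_cast hTne.card_pos
  nlinarith

open Pointwise in
lemma IsAmenable.folner {K : Type*} [Group K] [DecidableEq K] (hK : IsAmenable K)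
    (E : Finset K) (δ : ℝ) (hδ : 0 < δ) :
    ∃ S : Finset K, S.Nonempty ∧
      ∀ h ∈ E, ((S.filter fun s => s * h ∉ S).card : ℝ) ≤ δ * S.card := by
  obtain ⟨T, hT, hlt⟩ := hK.folner_left (insert 1 E⁻¹) δ hδ
  refine ⟨T⁻¹, by simpa using hT, fun h hh => ?_⟩
  have hsub : T ⊆ insert 1 E⁻¹ * T := by
    intro t ht
    exact Finset.mem_mul.2 ⟨1, by simp, t, ht, by simp⟩
  have h1 : (((insert 1 E⁻¹ * T) \ T).card : ℝ) ≤ δ * T.card := by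
    rw [Finset.card_sdiff_of_subset hsub, Nat.cast_sub (Finset.card_le_card hsub)]
    linarith
  have h2 : ((T⁻¹).filter fun s => s * h ∉ T⁻¹).card ≤ ((insert 1 E⁻¹ * T) \ T).card := by
    refine Finset.card_le_card_of_injOn (fun s => h⁻¹ * s⁻¹) ?_ ?_
    · intro s hs
      simp only [Finset.coe_filter, Finset.mem_inv', Set.mem_ofPred_eq, mul_inv_rev] at hs
      simp only [Finset.coe_sdiff, Set.mem_sdiff, Finset.mem_coe]
      exact ⟨Finset.mem_mul.2 ⟨h⁻¹, by simp [hh], s⁻¹, hs.1, rfl⟩, hs.2⟩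
    · intro a _ b _ hab
      simpa using hab
  rw [Finset.card_inv]
  refine le_trans ?_ h1
  exact_mod_cast h2


/-! ### Sofic approximations with a common good set -/

open Pointwise in
lemma IsSofic.good {Q : Type*} [Group Q] (hQ : IsSofic Q) (E : Finset Q) (ε : ℝ) (hε : 0 < ε) :
    ∃ A : Type, Finite A ∧ Nonempty A ∧ ∃ φ : Q → Equiv.Perm A, φ 1 = 1 ∧
      frac (fun a => ¬ ((∀ g ∈ E, ∀ h ∈ E, φ (g * h) a = φ g (φ h a)) ∧
        (∀ g ∈ E, ∀ h ∈ E, g ≠ h → φ g a ≠ φ h a))) ≤ ε := by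
  classical
  set D : Finset Q := E ∪ E⁻¹ ∪ E⁻¹ * E with hD
  set δ : ℝ := ε / ((D ×ˢ D).card + D.card + 1) with hδ
  have hδ0 : 0 < δ := by positivity
  obtain ⟨A, hA, hA', φ, h1, hmul, hfree⟩ := hQ D δ hδ0
  refine ⟨A, hA, hA', φ, h1, ?_⟩
  have hbad : ∀ a, ¬ ((∀ g ∈ E, ∀ h ∈ E, φ (g * h) a = φ g (φ h a)) ∧
        (∀ g ∈ E, ∀ h ∈ E, g ≠ h → φ g a ≠ φ h a)) →
      (∃ p ∈ D ×ˢ D, φ (p.1 * p.2) a ≠ (φ p.1 * φ p.2) a) ∨ (∃ g ∈ D, g ≠ 1 ∧ φ g a = a) := by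
    intro a
    contrapose!
    rintro ⟨H1, H2⟩
    have H1' : ∀ g ∈ D, ∀ h ∈ D, φ (g * h) a = φ g (φ h a) := fun g hg h hh =>
      H1 (g, h) (Finset.mem_product.2 ⟨hg, hh⟩)
    have hE : ∀ g ∈ E, g ∈ D := fun g hg => by simp [hD, hg]
    have hEi : ∀ g ∈ E, g⁻¹ ∈ D := fun g hg => by simp [hD, hg]
    have hEm : ∀ g ∈ E, ∀ h ∈ E, g⁻¹ * h ∈ D := fun g hg h hh => by
      rw [hD, Finset.mem_union]
      exact Or.inr (Finset.mul_mem_mul (by simpa using hg) hh)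
    refine ⟨fun g hg h hh => H1' g (hE g hg) h (hE h hh), fun g hg h hh hne heq => ?_⟩
    have e1 := H1' g⁻¹ (hEi g hg) h (hE h hh)
    have e2 := H1' g⁻¹ (hEi g hg) g (hE g hg)
    rw [inv_mul_cancel, h1, heq, ← e1] at e2
    exact H2 _ (hEm g hg h hh) (fun h' => hne (by rwa [inv_mul_eq_one] at h')) e2.symm
  refine (frac_mono hbad).trans ((frac_or_le _ _).trans ?_)
  have b1 := frac_exists_le_mul (D ×ˢ D) (fun p a => φ (p.1 * p.2) a ≠ (φ p.1 * φ p.2) a) δ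
    (fun p hp => by
      rw [Finset.mem_product] at hp
      exact (hmul p.1 hp.1 p.2 hp.2).le)
  have b2 := frac_exists_le_mul D (fun g a => g ≠ 1 ∧ φ g a = a) δ
    (fun g hg => by
      by_cases hg1 : g = 1
      · simp only [hg1, ne_eq, not_true_eq_false, false_and, frac_false]; exact hδ0.le
      · have := hfree g hg hg1
        rw [permDist_eq_frac, frac_not] at this
        have h3 : frac (fun a => g ≠ 1 ∧ φ g a = a) ≤ frac (fun a => φ g a = (1 : Equiv.Perm A) a) :=
          frac_mono fun a h => h.2
        linarith)
  have : ((D ×ˢ D).card + D.card + 1) * δ = ε := by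
    rw [hδ]; field_simp
  nlinarith

/-! ### Min-hash -/

lemma frac_sum_le_one {A ι : Type*} [Finite A] [Nonempty A] (s : Finset ι) (p : ι → A → Prop)
    (h : ∀ i ∈ s, ∀ j ∈ s, i ≠ j → ∀ a, p i a → p j a → False) :
    ∑ j ∈ s, frac (p j) ≤ 1 := by
  classical
  have : ∑ j ∈ s, frac (p j) = frac (fun a => ∃ j ∈ s, p j a) := by
    induction s using Finset.induction_on with
    | empty => simp [frac_false]
    | insert i s hi ih =>
      rw [Finset.sum_insert hi, ih (fun a ha b hb => h a (by simp [ha]) b (by simp [hb]))]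
      unfold frac
      rw [← add_div]
      congr 1
      rw [← Nat.cast_add, ← Set.ncard_union_eq]
      · congr 2; ext a; simp
      · rw [Set.disjoint_left]
        rintro a ha ⟨j, hj, hja⟩
        exact h i (by simp) j (by simp [hj]) (by rintro rfl; exact hi hj) a ha hja
  rw [this]
  exact frac_le_one _

lemma rank_argmin {X : Type*} [Finite X] {n : ℕ} [Nonempty (X ≃ Fin n)] (W : Finset X) (x : X)
    (hx : x ∈ W) :
    frac (fun ρ : X ≃ Fin n => ∀ y ∈ W, ρ x ≤ ρ y) ≤ 1 / W.card := by
  classical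
  have : Finite (X ≃ Fin n) := inferInstance
  have heq : ∀ y ∈ W, frac (fun ρ : X ≃ Fin n => ∀ z ∈ W, ρ y ≤ ρ z) =
      frac (fun ρ : X ≃ Fin n => ∀ z ∈ W, ρ x ≤ ρ z) := by
    intro y hy
    let e : (X ≃ Fin n) ≃ (X ≃ Fin n) :=
      { toFun := fun ρ => (Equiv.swap x y).trans ρ
        invFun := fun ρ => (Equiv.swap x y).trans ρ
        left_inv := fun ρ => by ext z; simp
        right_inv := fun ρ => by ext z; simp }
    rw [← frac_equiv e (fun ρ : X ≃ Fin n => ∀ z ∈ W, ρ x ≤ ρ z)]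
    congr 1
    ext ρ
    have hsw : ∀ z ∈ W, Equiv.swap x y z ∈ W := by
      intro z hz
      rw [Equiv.swap_apply_def]
      split_ifs <;> assumption
    simp only [e, Equiv.coe_fn_mk, Equiv.trans_apply, Equiv.swap_apply_left]
    constructor
    · intro h z hz; exact h _ (hsw z hz)
    · intro h z hz
      have := h _ (hsw z hz)
      simpa using this
  have h1 := frac_sum_le_one W (fun x (ρ : X ≃ Fin n) => ∀ y ∈ W, ρ x ≤ ρ y) (by
    intro i hi j hj hij ρ h1 h2
    exact hij (ρ.injective (le_antisymm (h1 j hj) (h2 i hi))))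
  rw [Finset.sum_congr rfl heq, Finset.sum_const, nsmul_eq_mul] at h1
  have hW : (0 : ℝ) < W.card := by exact_mod_cast Finset.card_pos.2 ⟨x, hx⟩
  rw [le_div_iff₀ hW]
  linarith

lemma minhash {X : Type*} [Finite X] [DecidableEq X] {n : ℕ} [Nonempty (X ≃ Fin n)]
    (U V : Finset X) (hU : U.Nonempty) (hV : V.Nonempty) :
    frac (fun ρ : X ≃ Fin n => U.inf' hU ρ ≠ V.inf' hV ρ) ≤
      ((U \ V ∪ V \ U).card : ℝ) * (1 / (U ∪ V).card) := by
  have : Finite (X ≃ Fin n) := inferInstance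
  refine le_trans (frac_mono ?_) (frac_exists_le_mul (U \ V ∪ V \ U)
    (fun x (ρ : X ≃ Fin n) => ∀ y ∈ U ∪ V, ρ x ≤ ρ y) _ ?_)
  · intro ρ hne
    obtain ⟨u, hu, hu'⟩ := Finset.exists_mem_eq_inf' hU ρ
    obtain ⟨v, hv, hv'⟩ := Finset.exists_mem_eq_inf' hV ρ
    have mu : ∀ y ∈ U, ρ u ≤ ρ y := fun y hy => hu' ▸ Finset.inf'_le ρ hy
    have mv : ∀ y ∈ V, ρ v ≤ ρ y := fun y hy => hv' ▸ Finset.inf'_le ρ hy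
    rw [hu', hv'] at hne
    rcases lt_or_gt_of_ne hne with h | h
    · refine ⟨u, ?_, ?_⟩
      · simp only [Finset.mem_union, Finset.mem_sdiff]
        exact Or.inl ⟨hu, fun h' => absurd (mv u h') (not_le.2 h)⟩
      · intro y hy
        rcases Finset.mem_union.1 hy with hy | hy
        · exact mu y hy
        · exact h.le.trans (mv y hy)
    · refine ⟨v, ?_, ?_⟩
      · simp only [Finset.mem_union, Finset.mem_sdiff]
        exact Or.inr ⟨hv, fun h' => absurd (mu v h') (not_le.2 h)⟩
      · intro y hy
        rcases Finset.mem_union.1 hy with hy | hy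
        · exact h.le.trans (mu y hy)
        · exact mv y hy
  · intro x hx
    apply rank_argmin
    simp only [Finset.mem_union, Finset.mem_sdiff] at hx ⊢
    tauto

/-- Existence of approximations together with labels which are almost `H`-invariant and
separate the elements outside `H`. -/
def LabelProp {G : Type*} [Group G] (H : Set G) : Prop :=
  ∀ (E : Finset G) (ε : ℝ), 0 < ε →
    ∃ A B : Type, Finite A ∧ Nonempty A ∧ Finite B ∧
      ∃ (φ : G → Equiv.Perm A) (b : A → B), φ 1 = 1 ∧
        frac (fun a => ¬ ((∀ g ∈ E, ∀ h ∈ E, φ (g * h) a = φ g (φ h a)) ∧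
          (∀ g ∈ E, g ≠ 1 → φ g a ≠ a) ∧
          (∀ g ∈ E, g ∈ H ↔ b (φ g a) = b a))) ≤ ε

open Pointwise in
lemma labelProp_of_amenable {Q K : Type*} [Group Q] [Group K] (hQ : IsSofic Q)
    (hK : IsAmenable K) (j : K →* Q) (hj : Function.Injective j) :
    LabelProp (j.range : Set Q) := by
  classical
  intro E ε hε
  set δ : ℝ := ε / (4 * (E.card + 1)) with hδ
  have hδ0 : 0 < δ := by positivity
  obtain ⟨S₀, hS₀, hfol⟩ := hK.folner (E.preimage j hj.injOn) δ hδ0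
  set S : Finset Q := S₀.image j with hS
  have hSne : S.Nonempty := hS₀.image _
  set D : Finset Q := insert 1 (E ∪ S ∪ S * E) with hD
  obtain ⟨A, hA, hA', φ, h1, hgood⟩ := hQ.good D (ε / 2) (by linarith)
  set n := Nat.card A with hn
  have hne : Nonempty (A ≃ Fin n) := ⟨Finite.equivFin A⟩
  have hfin : Finite (A ≃ Fin n) := inferInstance
  let P : A → Prop := fun a => (∀ g ∈ D, ∀ h ∈ D, φ (g * h) a = φ g (φ h a)) ∧
        (∀ g ∈ D, ∀ h ∈ D, g ≠ h → φ g a ≠ φ h a)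
  let U : A → Finset A := fun a => S.image (fun s => φ s a)
  have hU : ∀ a, (U a).Nonempty := fun a => hSne.image _
  have hD1 : (1 : Q) ∈ D := by simp [hD]
  have hDE : ∀ g ∈ E, g ∈ D := fun g hg => by simp [hD, hg]
  have hDS : ∀ g ∈ S, g ∈ D := fun g hg => by simp only [hD, Finset.mem_insert, Finset.mem_union]; tauto
  have hDSE : ∀ s ∈ S, ∀ g ∈ E, s * g ∈ D := fun s hs g hg => by
    simp only [hD, Finset.mem_insert, Finset.mem_union]
    exact Or.inr (Or.inr (Finset.mul_mem_mul hs hg))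
  have hSj : ∀ s ∈ S, s ∈ j.range := by
    intro s hs
    obtain ⟨k, _, rfl⟩ := Finset.mem_image.1 hs
    exact ⟨k, rfl⟩
  refine ⟨A × (A ≃ Fin n), Fin n, inferInstance, inferInstance, inferInstance,
    fun g => Equiv.prodCongr (φ g) (Equiv.refl _), fun x => (U x.1).inf' (hU x.1) x.2, ?_, ?_⟩
  · ext x <;> simp [h1]
  -- the two kinds of bad points
  have hbad : ∀ x : A × (A ≃ Fin n), ¬ ((∀ g ∈ E, ∀ h ∈ E,
        (Equiv.prodCongr (φ (g * h)) (Equiv.refl (A ≃ Fin n))) x =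
          (Equiv.prodCongr (φ g) (Equiv.refl _)) ((Equiv.prodCongr (φ h) (Equiv.refl _)) x)) ∧
          (∀ g ∈ E, g ≠ 1 → (Equiv.prodCongr (φ g) (Equiv.refl _)) x ≠ x) ∧
          (∀ g ∈ E, g ∈ (j.range : Set Q) ↔
            (U ((Equiv.prodCongr (φ g) (Equiv.refl (A ≃ Fin n))) x).1).inf' (hU _)
              ((Equiv.prodCongr (φ g) (Equiv.refl (A ≃ Fin n))) x).2 =
            (U x.1).inf' (hU x.1) x.2)) →
      ¬ P x.1 ∨ ∃ g ∈ E, (g ∈ j.range ∧ P x.1 ∧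
        (U (φ g x.1)).inf' (hU _) x.2 ≠ (U x.1).inf' (hU x.1) x.2) := by
    rintro ⟨a, ρ⟩
    contrapose!
    rintro ⟨⟨hP1, hP2⟩, hinv⟩
    refine ⟨?_, ?_, ?_⟩
    · intro g hg h hh
      simp [hP1 g (hDE g hg) h (hDE h hh)]
    · intro g hg hg1 heq
      apply hP2 g (hDE g hg) 1 hD1 hg1
      simpa [h1] using congrArg Prod.fst heq
    · intro g hg
      constructor
      · intro hgK
        exact hinv g hg hgK ⟨hP1, hP2⟩
      · intro heq
        simp only [Equiv.prodCongr_apply, Prod.map, Equiv.refl_apply] at heq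
        obtain ⟨u, hu, hu'⟩ := Finset.exists_mem_eq_inf' (hU (φ g a)) ρ
        obtain ⟨v, hv, hv'⟩ := Finset.exists_mem_eq_inf' (hU a) ρ
        rw [hu', hv'] at heq
        have heq := ρ.injective heq
        obtain ⟨s, hs, rfl⟩ := Finset.mem_image.1 hu
        obtain ⟨t, ht, rfl⟩ := Finset.mem_image.1 hv
        rw [← hP1 s (hDS s hs) g (hDE g hg)] at heq
        have hst : s * g = t := by
          by_contra hne
          exact hP2 _ (hDSE s hs g hg) _ (hDS t ht) hne heq
        have : g = s⁻¹ * t := by rw [← hst]; simp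
        rw [this]
        exact j.range.mul_mem (j.range.inv_mem (hSj s hs)) (hSj t ht)
  refine (frac_mono hbad).trans ((frac_or_le _ _).trans ?_)
  have b1 : frac (fun x : A × (A ≃ Fin n) => ¬ P x.1) ≤ ε / 2 := by
    rw [frac_prod_fst (fun a => ¬ P a)]; exact hgood
  have b2 := frac_exists_le_mul E (fun g (x : A × (A ≃ Fin n)) => (g ∈ j.range ∧ P x.1 ∧
        (U (φ g x.1)).inf' (hU _) x.2 ≠ (U x.1).inf' (hU x.1) x.2)) (2 * δ) (by
    intro g hg
    refine frac_prod_le (fun a (ρ : A ≃ Fin n) => (g ∈ j.range ∧ P a ∧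
        (U (φ g a)).inf' (hU _) ρ ≠ (U a).inf' (hU a) ρ)) _ ?_
    intro a
    by_cases hc : g ∈ j.range ∧ P a
    · obtain ⟨⟨k, rfl⟩, hP1, hP2⟩ := hc
      refine (frac_mono (fun ρ h => h.2.2)).trans ((minhash _ _ (hU _) (hU _)).trans ?_)
      set V := U (φ (j k) a) with hV
      have hinj : Set.InjOn (fun s => φ s a) (S : Set Q) := by
        intro s hs t ht h
        by_contra hne
        exact hP2 s (hDS s hs) t (hDS t ht) hne h
      have hVe : V = S.image (fun s => φ (s * j k) a) := by
        rw [hV]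
        apply Finset.image_congr
        intro s hs
        exact (hP1 s (hDS s hs) (j k) (hDE _ hg)).symm
      have hinjV : Set.InjOn (fun s => φ (s * j k) a) (S : Set Q) := by
        intro s hs t ht h
        by_contra hne
        exact hP2 _ (hDSE s hs _ hg) _ (hDSE t ht _ hg) (fun h => hne (mul_right_cancel h)) h
      have cU : (U a).card = S.card := Finset.card_image_of_injOn hinj
      have cV : V.card = S.card := by rw [hVe]; exact Finset.card_image_of_injOn hinjV
      have cS : S.card = S₀.card := Finset.card_image_of_injective _ hj
      have c1 : (V \ U a).card ≤ (S₀.filter fun s => s * k ∉ S₀).card := by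
        have : V \ U a ⊆ (S₀.filter fun s => s * k ∉ S₀).image (fun s => φ (j s * j k) a) := by
          intro y hy
          rw [Finset.mem_sdiff, hVe, Finset.mem_image] at hy
          obtain ⟨⟨s, hs, rfl⟩, hy2⟩ := hy
          obtain ⟨t, ht, rfl⟩ := Finset.mem_image.1 hs
          refine Finset.mem_image.2 ⟨t, Finset.mem_filter.2 ⟨ht, fun h => hy2 ?_⟩, rfl⟩
          refine Finset.mem_image.2 ⟨j (t * k), Finset.mem_image_of_mem _ h, ?_⟩
          simp
        exact (Finset.card_le_card this).trans Finset.card_image_le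
      have c2 : (U a \ V).card = (V \ U a).card := Finset.card_sdiff_comm (by rw [cU, cV])
      have c3 := hfol k (by simpa using hg)
      have c4 : ((V \ U a ∪ U a \ V).card : ℝ) ≤ 2 * (δ * S₀.card) := by
        have h := Finset.card_union_le (V \ U a) (U a \ V)
        have h' : (V \ U a ∪ U a \ V).card ≤ 2 * (S₀.filter fun s => s * k ∉ S₀).card := by omega
        have h'' : ((V \ U a ∪ U a \ V).card : ℝ) ≤
          2 * ((S₀.filter fun s => s * k ∉ S₀).card : ℝ) := by exact_mod_cast h'
        linarith
      have c5 : (S₀.card : ℝ) ≤ (V ∪ U a).card := by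
        have := Finset.card_le_card (Finset.subset_union_left (s₁ := V) (s₂ := U a))
        rw [cV, cS] at this
        exact_mod_cast this
      have c6 : (0 : ℝ) < S₀.card := by exact_mod_cast hS₀.card_pos
      rw [mul_one_div, div_le_iff₀ (by linarith)]
      nlinarith
    · refine le_trans (le_of_eq ?_) (by positivity : (0 : ℝ) ≤ 2 * δ)
      rw [← frac_false (A := A ≃ Fin n)]
      congr 1
      ext ρ
      simp only [iff_false]
      exact fun h => hc ⟨h.1, h.2.1⟩)
  have : (E.card + 1) * (4 * δ) = ε := by rw [hδ]; field_simp
  nlinarith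


lemma labelProp_of_sigma {G : Type*} [Group G] (hG : IsSofic G) (H : Subgroup G)
    (h : SigmaCoSofic H) : LabelProp (H : Set G) := by
  classical
  obtain ⟨Gi, Hi, mG, mH, sG, sH, hle, hco⟩ := h
  intro E ε hε
  -- choose the first index
  obtain ⟨i, hi⟩ : ∃ i, ∀ g ∈ E, g ∈ Gi i ∧ (g ∈ H → g ∈ Hi i) := by
    have : ∀ᶠ i in Filter.atTop, ∀ g ∈ E, g ∈ Gi i ∧ (g ∈ H → g ∈ Hi i) := by
      rw [Filter.eventually_all_finset]
      intro g _
      apply Filter.Eventually.and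
      · have hg : g ∈ ⨆ i, Gi i := by rw [sG]; trivial
        rw [Subgroup.mem_iSup_of_directed mG.directed_le] at hg
        obtain ⟨i, hi⟩ := hg
        filter_upwards [Filter.eventually_ge_atTop i] with k hk
        exact mG hk hi
      · by_cases hgH : g ∈ H
        · rw [← sH, Subgroup.mem_iSup_of_directed mH.directed_le] at hgH
          obtain ⟨i, hi⟩ := hgH
          filter_upwards [Filter.eventually_ge_atTop i] with k hk _
          exact mH hk hi
        · exact Filter.Eventually.of_forall fun _ h => absurd h hgH
    exact this.exists
  have hHle : Hi i ≤ H := by rw [← sH]; exact le_iSup Hi i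
  obtain ⟨w⟩ := hco i
  let e : G → Gi i := fun g => if h : g ∈ Gi i then ⟨g, h⟩ else 1
  have he : ∀ g (h : g ∈ Gi i), e g = ⟨g, h⟩ := fun g h => by simp [e, h]
  have hemul : ∀ g ∈ E, ∀ h ∈ E, e (g * h) = e g * e h := by
    intro g hg h hh
    rw [he g (hi g hg).1, he h (hi h hh).1, he _ ((Gi i).mul_mem (hi g hg).1 (hi h hh).1)]
    rfl
  -- choose the second index
  obtain ⟨k, hk⟩ : ∃ k, ∀ g ∈ E, (e g ∈ w.Gi k ↔ g ∈ H) := by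
    have : ∀ᶠ k in Filter.atTop, ∀ g ∈ E, (e g ∈ w.Gi k ↔ g ∈ H) := by
      rw [Filter.eventually_all_finset]
      intro g hg
      have hmem : g ∈ H ↔ ∀ k, e g ∈ w.Gi k := by
        rw [← Subgroup.mem_iInf, w.iInf_eq, Subgroup.mem_subgroupOf, he g (hi g hg).1]
        exact ⟨(hi g hg).2, fun h => hHle h⟩
      by_cases hgH : g ∈ H
      · exact Filter.Eventually.of_forall fun k => by
          simp only [hgH, iff_true]; exact hmem.1 hgH k
      · have := mt hmem.2 hgH
        push Not at this
        obtain ⟨k, hk⟩ := this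
        filter_upwards [Filter.eventually_ge_atTop k] with l hl
        simp only [hgH, iff_false]
        exact fun h => hk (w.antitone_G hl h)
    exact this.exists
  have hn := w.normal k
  let j : (w.Gi k ⧸ (w.Hi k).subgroupOf (w.Gi k)) →* (Gi i ⧸ w.Hi k) :=
    QuotientGroup.map _ _ (w.Gi k).subtype (fun x hx => hx)
  have hj : Function.Injective j := by
    rw [injective_iff_map_eq_one]
    intro x
    induction x using QuotientGroup.induction_on with
    | H x =>
      intro hx
      replace hx : ((x : Gi i) : Gi i ⧸ w.Hi k) = 1 := hx
      rw [QuotientGroup.eq_one_iff] at hx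
      rw [QuotientGroup.eq_one_iff]
      exact hx
  have hrange : ∀ x : Gi i, (x : Gi i ⧸ w.Hi k) ∈ j.range ↔ x ∈ w.Gi k := by
    intro x
    constructor
    · rintro ⟨y, hy⟩
      induction y using QuotientGroup.induction_on with
      | H y =>
        replace hy : ((y : Gi i) : Gi i ⧸ w.Hi k) = x := hy
        rw [QuotientGroup.eq] at hy
        have := w.le k hy
        have h2 := (w.Gi k).mul_mem y.2 this
        simpa using h2
    · intro hx
      exact ⟨((⟨x, hx⟩ : w.Gi k) : _ ⧸ _), rfl⟩
  let q : G → Gi i ⧸ w.Hi k := fun g => (e g : Gi i ⧸ w.Hi k)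
  obtain ⟨A, B, hA, hA', hB, φ, b, h1, hφ⟩ :=
    labelProp_of_amenable (w.sofic k) (w.amenable k) j hj (E.image q) (ε / 2) (by linarith)
  obtain ⟨A₀, hA₀, hA₀', φ₀, h1₀, hφ₀⟩ := hG.good (insert 1 E) (ε / 2) (by linarith)
  refine ⟨A₀ × A, B, inferInstance, inferInstance, hB,
    fun g => Equiv.prodCongr (φ₀ g) (φ (q g)), fun x => b x.2, ?_, ?_⟩
  · have : q 1 = 1 := by
      simp only [q, he 1 (Gi i).one_mem]
      exact QuotientGroup.mk_one _
    ext x <;> simp [h1₀, h1, this]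
  · rw [← frac_prod_fst (C := A)] at hφ₀
    rw [← frac_prod_snd (A := A₀)] at hφ
    refine le_trans (frac_mono ?_) ((frac_or_le _ _).trans ((add_le_add hφ₀ hφ).trans (by linarith)))
    rintro ⟨a, c⟩
    contrapose!
    rintro ⟨⟨H1, H2⟩, H3, H4, H5⟩
    have hE : ∀ g ∈ E, g ∈ insert 1 E := fun g hg => Finset.mem_insert_of_mem hg
    have hq : ∀ g ∈ E, q g ∈ E.image q := fun g hg => Finset.mem_image_of_mem _ hg
    refine ⟨?_, ?_, ?_⟩
    · intro g hg h hh
      have hqm : q (g * h) = q g * q h := by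
        simp only [q, hemul g hg h hh]
        exact QuotientGroup.mk_mul _ _ _
      ext
      · simp [H1 g (hE g hg) h (hE h hh)]
      · simp [hqm, H3 _ (hq g hg) _ (hq h hh)]
    · intro g hg hg1 heq
      refine H2 g (hE g hg) 1 (by simp) hg1 ?_
      simpa [h1₀] using congrArg Prod.fst heq
    · intro g hg
      rw [SetLike.mem_coe, ← hk g hg]
      have := H5 (q g) (hq g hg)
      rw [SetLike.mem_coe, hrange] at this
      exact this


/-! ### Separating words of the free group in finite groups -/

lemma free_sep {α : Type} (𝓛 : Set (List (α × Bool))) (h𝓛 : 𝓛.Finite) :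
    ∃ (C : Type) (_ : Group C) (_ : Finite C) (π : FreeGroup α →* C),
      ∀ l ∈ 𝓛, FreeGroup.mk l ≠ 1 → π (FreeGroup.mk l) ≠ 1 := by
  classical
  set S : Set (FreeGroup α) := insert 1 (FreeGroup.mk '' (⋃ l ∈ 𝓛, {l' | l' ∈ l.tails})) with hS
  have hSfin : S.Finite := by
    refine Set.Finite.insert _ (Set.Finite.image _ (h𝓛.biUnion fun l _ => ?_))
    exact List.finite_toSet l.tails
  have hfS : Finite S := hSfin.to_subtype
  have := Fintype.ofFinite S
  have hσ : ∀ x : α, ∃ σ : Equiv.Perm S, ∀ s : S, ∀ (h : FreeGroup.of x * s.1 ∈ S),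
      σ s = ⟨FreeGroup.of x * s.1, h⟩ := by
    intro x
    let e : {s : S // FreeGroup.of x * s.1 ∈ S} ≃ {s : S // (FreeGroup.of x)⁻¹ * s.1 ∈ S} :=
      { toFun := fun s => ⟨⟨FreeGroup.of x * s.1.1, s.2⟩, by simp⟩
        invFun := fun s => ⟨⟨(FreeGroup.of x)⁻¹ * s.1.1, s.2⟩, by simp⟩
        left_inv := fun s => by simp
        right_inv := fun s => by simp }
    refine ⟨e.extendSubtype, fun s h => ?_⟩
    rw [Equiv.extendSubtype_apply_of_mem e s h]
    rfl
  choose σ hσ using hσ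
  have h1S : (1 : FreeGroup α) ∈ S := by simp [hS]
  refine ⟨Equiv.Perm S, inferInstance, inferInstance, FreeGroup.lift σ, ?_⟩
  have key : ∀ l : List (α × Bool), (∀ l' ∈ l.tails, FreeGroup.mk l' ∈ S) →
      ((FreeGroup.lift σ (FreeGroup.mk l)) ⟨1, h1S⟩).1 = FreeGroup.mk l := by
    intro l
    induction l with
    | nil => intro _; rw [← FreeGroup.one_eq_mk]; simp
    | cons x l ih =>
      intro hl
      have hl' : ∀ l' ∈ l.tails, FreeGroup.mk l' ∈ S := fun l' h => hl l' (by simp at h ⊢; exact Or.inr h)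
      have ih := ih hl'
      have hx : FreeGroup.mk (x :: l) ∈ S := hl _ (by simp)
      have hlS : FreeGroup.mk l ∈ S := hl' _ (by simp)
      have ih' : (FreeGroup.lift σ (FreeGroup.mk l)) ⟨1, h1S⟩ = ⟨FreeGroup.mk l, hlS⟩ :=
        Subtype.ext ih
      obtain ⟨x, b⟩ := x
      have e1 : FreeGroup.mk ((x, b) :: l) = FreeGroup.mk [(x, b)] * FreeGroup.mk l := by
        rw [FreeGroup.mul_mk]; rfl
      cases b with
      | true =>
        have e2 : FreeGroup.mk [(x, true)] = FreeGroup.of x := rfl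
        rw [e1, e2] at hx ⊢
        rw [map_mul, Equiv.Perm.mul_apply, ih', FreeGroup.lift_apply_of, hσ x _ hx]
      | false =>
        have e2 : FreeGroup.mk [(x, false)] = (FreeGroup.of x)⁻¹ := rfl
        rw [e1, e2] at hx ⊢
        rw [map_mul, Equiv.Perm.mul_apply, ih', map_inv, FreeGroup.lift_apply_of]
        have : (σ x)⁻¹ ⟨FreeGroup.mk l, hlS⟩ = ⟨_, hx⟩ := by
          rw [Equiv.Perm.inv_eq_iff_eq, hσ x _ (by simpa using hlS)]
          simp
        rw [this]
  intro l hl hne heq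
  have := key l (fun l' h => by
    rw [hS]
    refine Set.mem_insert_of_mem _ ⟨l', ?_, rfl⟩
    simp only [Set.mem_iUnion]
    exact ⟨l, hl, h⟩)
  rw [heq] at this
  exact hne this.symm

/-! ### Metric quotients -/

section Quot

open Filter Topology

variable {I : Type*} (l : Filter I) (X : I → Type) [∀ i, Finite (X i)]

def nullSub : Subgroup (∀ i, Equiv.Perm (X i)) where
  carrier := {σ | Tendsto (fun i => frac (fun x => σ i x ≠ x)) l (𝓝 0)}
  one_mem' := by simp [frac_false, tendsto_const_nhds]
  mul_mem' := by
    intro σ τ hσ hτ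
    have := Tendsto.add hσ hτ
    rw [add_zero] at this
    refine squeeze_zero (fun i => frac_nonneg _) (fun i => ?_) this
    rw [← frac_equiv (τ i) (fun x => σ i x ≠ x)]
    refine (frac_mono ?_).trans (frac_or_le _ _)
    intro x hx
    by_contra! hcon
    apply hx
    exact hcon.1.trans hcon.2
  inv_mem' := by
    intro σ hσ
    refine hσ.congr fun i => ?_
    rw [← frac_equiv (σ i) (fun x => (σ⁻¹) i x ≠ x)]
    congr 1
    ext x
    simp [eq_comm]

lemma mem_nullSub (σ : ∀ i, Equiv.Perm (X i)) :
    σ ∈ nullSub l X ↔ Tendsto (fun i => frac (fun x => σ i x ≠ x)) l (𝓝 0) := Iff.rfl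

instance nullSub_normal : (nullSub l X).Normal where
  conj_mem := by
    intro σ hσ τ
    rw [mem_nullSub] at hσ ⊢
    refine hσ.congr fun i => ?_
    rw [← frac_equiv (τ i) (fun x => (τ * σ * τ⁻¹) i x ≠ x)]
    congr 1
    ext x
    simp

lemma nullSub_mk_eq (σ τ : ∀ i, Equiv.Perm (X i)) :
    (σ : (∀ i, Equiv.Perm (X i)) ⧸ nullSub l X) = τ ↔
      Tendsto (fun i => frac (fun x => σ i x ≠ τ i x)) l (𝓝 0) := by
  rw [QuotientGroup.eq, mem_nullSub]
  have : (fun i => frac (fun x => (σ⁻¹ * τ) i x ≠ x)) =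
      (fun i => frac (fun x => σ i x ≠ τ i x)) := by
    ext i
    congr 1
    ext x
    simp only [Pi.mul_apply, Pi.inv_apply, Equiv.Perm.mul_apply, ne_eq, Equiv.Perm.inv_eq_iff_eq]
    rw [eq_comm]
  rw [this]

lemma sofic_of_hom {P : Type*} [Group P] [l.NeBot] [∀ i, Nonempty (X i)]
    (Ψ : P →* (∀ i, Equiv.Perm (X i)) ⧸ nullSub l X)
    (h : ∀ p ≠ 1, ∃ σ : ∀ i, Equiv.Perm (X i), (σ : (∀ i, Equiv.Perm (X i)) ⧸ nullSub l X) = Ψ p ∧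
      Tendsto (fun i => frac (fun x => σ i x = x)) l (𝓝 0)) : IsSofic P := by
  classical
  intro F ε hε
  choose s hs hs' using h
  let t : P → ∀ i, Equiv.Perm (X i) := fun p => if hp : p = 1 then 1 else s p hp
  have ht : ∀ p, (t p : (∀ i, Equiv.Perm (X i)) ⧸ nullSub l X) = Ψ p := by
    intro p
    by_cases hp : p = 1
    · simp [t, hp]
    · simp only [t, hp, dite_false]; exact hs p hp
  have H1 : ∀ᶠ i in l, ∀ g ∈ F, ∀ h ∈ F, permDist (t (g * h) i) (t g i * t h i) < ε := by
    simp only [eventually_all_finset]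
    intro g _ h _
    have : (t (g * h) : (∀ i, Equiv.Perm (X i)) ⧸ nullSub l X) = ((t g * t h : ∀ i, Equiv.Perm (X i))) := by
      rw [QuotientGroup.mk_mul, ht, ht, ht, map_mul]
    rw [nullSub_mk_eq] at this
    exact this.eventually (gt_mem_nhds hε)
  have H2 : ∀ᶠ i in l, ∀ g ∈ F, g ≠ 1 → 1 - ε < permDist (t g i) 1 := by
    simp only [eventually_all_finset]
    intro g _
    by_cases hg : g = 1
    · simp [hg]
    · filter_upwards [(hs' g hg).eventually (gt_mem_nhds hε)] with i hi _
      rw [permDist_eq_frac, frac_not]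
      simp only [t, hg, dite_false, Equiv.Perm.one_apply]
      linarith
  obtain ⟨i, h1, h2⟩ := (H1.and H2).exists
  exact ⟨X i, inferInstance, inferInstance, fun p => t p i, by simp [t], h1, h2⟩

end Quot

/-! ### Normal forms -/

lemma pushout_normal_form {G : Type*} [Group G] (H : Subgroup G)
    (p : Monoid.PushoutI (fun _ : ℕ => H.subtype)) :
    ∃ (h : H) (L : List (Σ _ : ℕ, G)), L.IsChain (fun x y => x.1 ≠ y.1) ∧ (∀ x ∈ L, x.2 ∉ H) ∧
      p = Monoid.PushoutI.base (fun _ : ℕ => H.subtype) h *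
        (L.map fun x => (Monoid.PushoutI.of x.1 x.2 :
          Monoid.PushoutI (fun _ : ℕ => H.subtype))).prod := by
  classical
  obtain ⟨d⟩ := Monoid.PushoutI.NormalWord.transversal_nonempty (fun _ : ℕ => H.subtype)
    (fun _ => H.subtype_injective)
  let w : Monoid.PushoutI.NormalWord d := Monoid.PushoutI.NormalWord.equiv p
  have hw : w.prod = p := Monoid.PushoutI.NormalWord.equiv.symm_apply_apply p
  refine ⟨w.head, w.toList, w.chain_ne, ?_, ?_⟩
  · rintro ⟨i, g⟩ hx hg
    have hs := w.normalized i g hx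
    have h1 := w.ne_one _ hx
    apply h1
    have hr : g ∈ ((H.subtype).range : Set G) := by simpa using hg
    have := (d.compl i).1 (a₁ := (⟨g, hr⟩, ⟨1, d.one_mem i⟩))
      (a₂ := (⟨1, (H.subtype).range.one_mem⟩, ⟨g, hs⟩)) (by simp)
    simpa using congrArg (fun z => z.1.1) this
  · rw [← hw, Monoid.PushoutI.NormalWord.prod, Monoid.CoprodI.Word.prod, map_list_prod,
      List.map_map]
    congr 3


/-! ### The model of the amalgam -/

section Model

variable {G A B C : Type*} [Group C]

def trajP (φ : G → Equiv.Perm A) : List (Σ _ : ℕ, G) → Equiv.Perm A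
  | [] => 1
  | x :: L => φ x.2 * trajP φ L

def wd (φ : G → Equiv.Perm A) (b : A → B) : List (Σ _ : ℕ, G) → A → List ((B × ℕ) × Bool)
  | [], _ => []
  | x :: L, a => ((b (φ x.2 (trajP φ L a)), x.1), true) ::
      ((b (trajP φ L a), x.1), false) :: wd φ b L a

def badP (φ : G → Equiv.Perm A) (b : A → B) : List (Σ _ : ℕ, G) → A → Prop
  | [], _ => False
  | x :: L, a => b (φ x.2 (trajP φ L a)) = b (trajP φ L a) ∨ badP φ b L a

lemma wd_length (φ : G → Equiv.Perm A) (b : A → B) (L : List (Σ _ : ℕ, G)) (a : A) :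
    (wd φ b L a).length = 2 * L.length := by
  induction L with
  | nil => rfl
  | cons x L ih => simp [wd, ih]; ring

lemma wd_idx (φ : G → Equiv.Perm A) (b : A → B) (L : List (Σ _ : ℕ, G)) (a : A) (n : ℕ)
    (h : ∀ x ∈ L, x.1 < n) : ∀ y ∈ wd φ b L a, y.1.2 < n := by
  induction L with
  | nil => simp [wd]
  | cons x L ih =>
    have h1 := h x (by simp)
    have h2 := ih (fun y hy => h y (by simp [hy]))
    intro y hy
    simp only [wd, List.mem_cons] at hy
    rcases hy with rfl | rfl | hy
    · exact h1
    · exact h1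
    · exact h2 y hy

lemma wd_reduced (φ : G → Equiv.Perm A) (b : A → B) (L : List (Σ _ : ℕ, G)) (a : A)
    (hL : L.IsChain (fun x y => x.1 ≠ y.1)) (ha : ¬ badP φ b L a) :
    FreeGroup.IsReduced (wd φ b L a) := by
  induction L with
  | nil => exact FreeGroup.IsReduced.nil
  | cons x L ih =>
    simp only [badP, not_or] at ha
    have ih := ih hL.tail ha.2
    simp only [wd]
    rw [FreeGroup.isReduced_cons_cons]
    refine ⟨fun h => absurd (congrArg Prod.fst h) ha.1, ?_⟩
    cases L with
    | nil => exact FreeGroup.IsReduced.singleton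
    | cons y L =>
      simp only [wd] at ih ⊢
      rw [FreeGroup.isReduced_cons_cons]
      refine ⟨fun h => absurd (congrArg Prod.snd h) ?_, ih⟩
      exact (List.isChain_cons_cons.1 hL).1

lemma wd_ne_one (φ : G → Equiv.Perm A) (b : A → B) (L : List (Σ _ : ℕ, G)) (a : A)
    (hL : L.IsChain (fun x y => x.1 ≠ y.1)) (ha : ¬ badP φ b L a) (hne : L ≠ []) :
    FreeGroup.mk (wd φ b L a) ≠ 1 := by
  classical
  intro h
  have h1 := (wd_reduced φ b L a hL ha).reduce_eq
  rw [← FreeGroup.toWord_mk, h, FreeGroup.toWord_one] at h1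
  have h2 := wd_length φ b L a
  rw [← h1] at h2
  simp at h2
  exact hne h2

def shearP (b : A → B) (π : FreeGroup (B × ℕ) →* C) (n : ℕ) : Equiv.Perm (A × C) where
  toFun x := (x.1, π (FreeGroup.of (b x.1, n)) * x.2)
  invFun x := (x.1, (π (FreeGroup.of (b x.1, n)))⁻¹ * x.2)
  left_inv x := by simp
  right_inv x := by simp

def liftP (σ : Equiv.Perm A) : Equiv.Perm (A × C) := Equiv.prodCongr σ (Equiv.refl C)

lemma model_apply (φ : G → Equiv.Perm A) (b : A → B) (π : FreeGroup (B × ℕ) →* C)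
    (L : List (Σ _ : ℕ, G)) (a : A) (c : C) :
    ((L.map fun x : (Σ _ : ℕ, G) => (shearP b π x.1 * liftP (φ x.2) * (shearP b π x.1)⁻¹ :
      Equiv.Perm (A × C))).prod : Equiv.Perm (A × C)) (a, c) =
      (trajP φ L a, π (FreeGroup.mk (wd φ b L a)) * c) := by
  induction L with
  | nil => simp [trajP, wd, ← FreeGroup.one_eq_mk]
  | cons x L ih =>
    rw [List.map_cons, List.prod_cons, Equiv.Perm.mul_apply, ih]
    have e : FreeGroup.mk (wd φ b (x :: L) a) = FreeGroup.of (b (φ x.2 (trajP φ L a)), x.1) *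
        (FreeGroup.of (b (trajP φ L a), x.1))⁻¹ * FreeGroup.mk (wd φ b L a) := by
      simp only [wd, FreeGroup.of, FreeGroup.inv_mk, FreeGroup.mul_mk]
      rfl
    rw [e, map_mul, map_mul, map_inv]
    have hinv : ∀ y : A × C, (shearP b π x.1)⁻¹ y =
      (y.1, (π (FreeGroup.of (b y.1, x.1)))⁻¹ * y.2) := fun y => rfl
    rw [Equiv.Perm.mul_apply, hinv]
    simp only [Equiv.Perm.mul_apply, liftP, shearP, trajP, Equiv.prodCongr_apply, Prod.map,
      Equiv.refl_apply, Equiv.coe_fn_mk, mul_assoc]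

end Model

lemma push_hom {G M R : Type*} [Group G] [Group M] [Group R] (H : Subgroup G) (q : M →* R)
    (Φ₀ : G → M) (T : ℕ → M) (h1 : ∀ g h, q (Φ₀ (g * h)) = q (Φ₀ g * Φ₀ h))
    (h2 : ∀ n, ∀ g ∈ H, q (T n * Φ₀ g) = q (Φ₀ g * T n)) :
    ∃ Ψ : Monoid.PushoutI (fun _ : ℕ => H.subtype) →* R, ∀ (h : H) (L : List (Σ _ : ℕ, G)),
      q (Φ₀ h * (L.map fun x => T x.1 * Φ₀ x.2 * (T x.1)⁻¹).prod) =
        Ψ (Monoid.PushoutI.base (fun _ : ℕ => H.subtype) h *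
        (L.map fun x => (Monoid.PushoutI.of x.1 x.2 :
          Monoid.PushoutI (fun _ : ℕ => H.subtype))).prod) := by
  let Φ : G →* R := MonoidHom.mk' (fun g => q (Φ₀ g)) (by
    intro g h
    rw [h1, map_mul])
  have hΦ : ∀ g, Φ g = q (Φ₀ g) := fun g => rfl
  let Θ : ℕ → G →* R := fun n => (MulAut.conj (q (T n))).toMonoidHom.comp Φ
  have hΘ : ∀ n g, Θ n g = q (T n * Φ₀ g * (T n)⁻¹) := by
    intro n g
    simp [Θ, hΦ]
  have hΘH : ∀ n, (Θ n).comp H.subtype = Φ.comp H.subtype := by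
    intro n
    ext ⟨g, hg⟩
    simp only [MonoidHom.comp_apply, Subgroup.subtype_apply]
    rw [hΘ, hΦ, map_mul, map_inv, mul_inv_eq_iff_eq_mul, ← map_mul]
    exact h2 n g hg
  refine ⟨Monoid.PushoutI.lift Θ (Φ.comp H.subtype) hΘH, fun h L => ?_⟩
  rw [map_mul, map_mul, map_list_prod, map_list_prod, List.map_map, List.map_map]
  congr 1
  congr 2
  ext x
  simp only [Function.comp]
  rw [← hΘ]
  rw [Monoid.PushoutI.lift_of]

open Filter Topology in
theorem pushout_core {G : Type*} [Group G] (H : Subgroup G) {I : Type*} (l : Filter I) [l.NeBot]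
    (A B C : I → Type) [∀ i, Finite (A i)] [∀ i, Nonempty (A i)] [∀ i, Group (C i)]
    [∀ i, Finite (C i)] (φ : ∀ i, G → Equiv.Perm (A i)) (b : ∀ i, A i → B i)
    (π : ∀ i, FreeGroup (B i × ℕ) →* C i)
    (hmul : ∀ g h, Tendsto (fun i => frac (fun a => φ i (g * h) a ≠ φ i g (φ i h a))) l (𝓝 0))
    (hfree : ∀ g ≠ 1, Tendsto (fun i => frac (fun a => φ i g a = a)) l (𝓝 0))
    (hin : ∀ g ∈ H, Tendsto (fun i => frac (fun a => b i (φ i g a) ≠ b i a)) l (𝓝 0))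
    (hout : ∀ g ∉ H, Tendsto (fun i => frac (fun a => b i (φ i g a) = b i a)) l (𝓝 0))
    (hsep : ∀ n : ℕ, ∀ᶠ i in l, ∀ w : List ((B i × ℕ) × Bool), w.length ≤ n →
      (∀ x ∈ w, x.1.2 < n) → FreeGroup.mk w ≠ 1 → π i (FreeGroup.mk w) ≠ 1) :
    IsSofic (Monoid.PushoutI (fun _ : ℕ => H.subtype)) := by
  classical
  let Φ₀ : G → ∀ i, Equiv.Perm (A i × C i) := fun g i => liftP (φ i g)
  let T : ℕ → ∀ i, Equiv.Perm (A i × C i) := fun n i => shearP (b i) (π i) n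
  have hm1 : ∀ g h, QuotientGroup.mk' (nullSub l fun i => A i × C i) (Φ₀ (g * h)) =
      QuotientGroup.mk' (nullSub l fun i => A i × C i) (Φ₀ g * Φ₀ h) := by
    intro g h
    refine (nullSub_mk_eq l (fun i => A i × C i) _ _).2 ?_
    refine (hmul g h).congr fun i => ?_
    rw [← frac_prod_fst (C := C i)]
    congr 1
    ext ⟨a, c⟩
    change _ ↔ (φ i (g * h) a, c) ≠ (φ i g (φ i h a), c)
    rw [ne_eq, ne_eq, Prod.ext_iff]
    simp
  have hm2 : ∀ n, ∀ g ∈ H, QuotientGroup.mk' (nullSub l fun i => A i × C i) (T n * Φ₀ g) =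
      QuotientGroup.mk' (nullSub l fun i => A i × C i) (Φ₀ g * T n) := by
    intro n g hg
    refine (nullSub_mk_eq l (fun i => A i × C i) _ _).2 ?_
    refine squeeze_zero (fun i => frac_nonneg _) (fun i => ?_) (hin g hg)
    refine (frac_mono ?_).trans
      (frac_prod_fst (C := C i) (fun a => b i (φ i g a) ≠ b i a)).le
    rintro ⟨a, c⟩ hne heq
    apply hne
    change (φ i g a, π i (FreeGroup.of (b i (φ i g a), n)) * c) =
      (φ i g a, π i (FreeGroup.of (b i a, n)) * c)
    have heq' : b i (φ i g a) = b i a := heq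
    rw [heq']
  obtain ⟨Ψ, hΨ⟩ := push_hom H _ Φ₀ T hm1 hm2
  refine sofic_of_hom l (fun i => A i × C i) Ψ ?_
  intro p hp
  obtain ⟨h, L, hchain, hLH, rfl⟩ := pushout_normal_form H p
  refine ⟨Φ₀ h * (L.map fun x => T x.1 * Φ₀ x.2 * (T x.1)⁻¹).prod, hΨ h L, ?_⟩
  · have happ : ∀ i (x : A i × C i), (Φ₀ h * (L.map fun x => T x.1 * Φ₀ x.2 * (T x.1)⁻¹).prod) i x =
        (φ i h (trajP (φ i) L x.1), π i (FreeGroup.mk (wd (φ i) (b i) L x.1)) * x.2) := by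
      rintro i ⟨a, c⟩
      have h1 : ((L.map fun x => T x.1 * Φ₀ x.2 * (T x.1)⁻¹).prod) i =
          (L.map fun x => shearP (b i) (π i) x.1 * liftP (φ i x.2) *
            (shearP (b i) (π i) x.1)⁻¹).prod := by
        refine (map_list_prod (Pi.evalMonoidHom (fun i => Equiv.Perm (A i × C i)) i) _).trans ?_
        rw [List.map_map]
        rfl
      rw [Pi.mul_apply, h1, Equiv.Perm.mul_apply, model_apply]
      rfl
    by_cases hL : L = []
    · subst hL
      have hh : (h : G) ≠ 1 := by
        intro hh
        apply hp
        have : h = 1 := Subtype.ext hh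
        simp [this]
      refine (hfree h hh).congr fun i => ?_
      rw [← frac_prod_fst (C := C i)]
      congr 1
      ext x
      rw [happ]
      simp [trajP, wd, Prod.ext_iff, ← FreeGroup.one_eq_mk]
    · have hbad : Tendsto (fun i => frac (badP (φ i) (b i) L)) l (𝓝 0) := by
        clear happ hL hchain hp
        induction L with
        | nil => simp [badP, frac]
        | cons x L ih =>
          have t1 := ih (fun y hy => hLH y (by simp [hy]))
          have t2 := hout x.2 (hLH x (by simp))
          have t3 := t2.add t1
          rw [add_zero] at t3
          refine squeeze_zero (fun i => frac_nonneg _) (fun i => ?_) t3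
          rw [← frac_equiv (trajP (φ i) L) (fun a => b i (φ i x.2 a) = b i a)]
          exact frac_or_le _ _
      obtain ⟨n, hn1, hn2⟩ : ∃ n, 2 * L.length ≤ n ∧ ∀ x ∈ L, x.1 < n := by
        refine ⟨2 * L.length + (L.map fun x => x.1 + 1).sum, by omega, fun x hx => ?_⟩
        have := List.single_le_sum (l := L.map fun x => x.1 + 1) (by simp) (x.1 + 1)
          (List.mem_map.2 ⟨x, hx, rfl⟩)
        omega
      refine tendsto_of_tendsto_of_tendsto_of_le_of_le' tendsto_const_nhds hbad
        (Eventually.of_forall fun i => frac_nonneg _) ?_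
      filter_upwards [hsep n] with i hi
      refine (frac_mono ?_).trans (frac_prod_fst (C := C i) (badP (φ i) (b i) L)).le
      rintro ⟨a, c⟩ hfix
      by_contra hgood
      rw [happ] at hfix
      have h2 := congrArg Prod.snd hfix
      simp only [mul_eq_right] at h2
      refine hi _ ?_ ?_ (wd_ne_one _ _ _ _ hchain hgood hL) h2
      · rw [wd_length]; exact hn1
      · exact wd_idx _ _ _ _ _ hn2

open Filter Topology in
theorem sofic_of_labelProp {G : Type*} [Group G] (H : Subgroup G) (hl : LabelProp (H : Set G)) :
    IsSofic (Monoid.PushoutI (fun _ : ℕ => H.subtype)) := by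
  classical
  have hpos : ∀ i : Finset G × ℕ, (0 : ℝ) < 1 / ((i.2 : ℝ) + 1) := fun i => by positivity
  choose A B hA hA' hB φ b h1 hφ using fun i : Finset G × ℕ => hl i.1 (1 / ((i.2 : ℝ) + 1)) (hpos i)
  have hlists : ∀ i : Finset G × ℕ, {w : List ((B i × ℕ) × Bool) | w.length ≤ i.2 ∧
      ∀ x ∈ w, x.1.2 < i.2}.Finite := by
    intro i
    have := hB i
    refine ((List.finite_length_le ((B i × Fin i.2) × Bool) i.2).image
      (List.map fun x => ((x.1.1, (x.1.2 : ℕ)), x.2))).subset ?_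
    rintro w ⟨hw1, hw2⟩
    refine ⟨w.pmap (fun x h => ((x.1.1, ⟨x.1.2, h⟩), x.2)) hw2, by simpa using hw1, ?_⟩
    rw [List.map_pmap]
    simp
  choose C hC hC' π hπ using fun i => free_sep _ (hlists i)
  have hlim : Tendsto (fun i : Finset G × ℕ => 1 / ((i.2 : ℝ) + 1)) atTop (𝓝 0) := by
    have := tendsto_one_div_add_atTop_nhds_zero_nat (𝕜 := ℝ)
    refine this.comp ?_
    rw [← prod_atTop_atTop_eq]
    exact tendsto_snd
  have hev : ∀ E : Finset G, ∀ᶠ i : Finset G × ℕ in atTop, E ⊆ i.1 := by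
    intro E
    filter_upwards [eventually_ge_atTop (E, 0)] with i hi using hi.1
  have gen : ∀ (E : Finset G) (p : ∀ i, A i → Prop),
      (∀ i, E ⊆ i.1 → ∀ a, p i a → ¬ ((∀ g ∈ i.1, ∀ h ∈ i.1, φ i (g * h) a = φ i g (φ i h a)) ∧
          (∀ g ∈ i.1, g ≠ 1 → φ i g a ≠ a) ∧
          (∀ g ∈ i.1, g ∈ (H : Set G) ↔ b i (φ i g a) = b i a))) →
      Tendsto (fun i => frac (p i)) atTop (𝓝 0) := by
    intro E p hp
    refine tendsto_of_tendsto_of_tendsto_of_le_of_le' tendsto_const_nhds hlim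
        (Eventually.of_forall fun i => frac_nonneg _) ?_
    filter_upwards [hev E] with i hi
    exact (frac_mono (hp i hi)).trans (hφ i)
  refine pushout_core H atTop A B C φ b π ?_ ?_ ?_ ?_ ?_
  · intro g h
    refine gen {g, h} _ fun i hi a hne hgood => hne (hgood.1 g (hi (by simp)) h (hi (by simp)))
  · intro g hg
    refine gen {g} _ fun i hi a heq hgood => hgood.2.1 g (hi (by simp)) hg heq
  · intro g hg
    refine gen {g} _ fun i hi a hne hgood => hne ((hgood.2.2 g (hi (by simp))).1 hg)
  · intro g hg
    refine gen {g} _ fun i hi a heq hgood => hg ((hgood.2.2 g (hi (by simp))).2 heq)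
  · intro n
    filter_upwards [eventually_ge_atTop ((∅ : Finset G), n)] with i hi w hw1 hw2
    have hi2 : n ≤ i.2 := hi.2
    exact hπ i w ⟨hw1.trans hi2, fun x hx => (hw2 x hx).trans_le hi2⟩


/-- If `G` is a countable sofic group and `H` is a σ-co-sofic subgroup of `G`, then the
amalgamated free product of countably infinitely many copies of `G` over `H` is sofic. -/
theorem isSofic_pushoutI_of_sigmaCoSofic {G : Type*} [Group G] [Countable G]
    (hG : IsSofic G) (H : Subgroup G) (h : SigmaCoSofic H) :
    IsSofic (Monoid.PushoutI (fun _ : ℕ => H.subtype)) := by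
  exact sofic_of_labelProp H (labelProp_of_sigma hG H h)
end

section
/- Let G be a countable sofic group and H a separable subgroup of G, i.e., there exists a sequence (G_i)_{i∈ℕ} of finite-index subgroups of G with ∩_i G_i = H. Then the amalgamated free product ∗_H G of countably infinitely many copies of G amalgamated over H (each copy of H identified via the same inclusion H ↪ G) is sofic. In particular, the double G ∗_H G of a sofic group G over a finite-index subgroup H is sofic. -/
universe u v

open Classical in
/-- partial swap -/
noncomputable def swFun {ι Q Y : Type*} [Group Q] (P : Subgroup Q) (s : Equiv.Perm Y)
    (a : Y → Option ι) (g : Y → Q) (i : ι) (x : Q × Y) : Q × Y :=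
  if x.1 ∈ P ∧ a x.2 = some i then (x.1 * g x.2, s x.2)
  else if a (s.symm x.2) = some i ∧ x.1 * (g (s.symm x.2))⁻¹ ∈ P then
    (x.1 * (g (s.symm x.2))⁻¹, s.symm x.2)
  else x

lemma swFun_invol {ι Q Y : Type*} [Group Q] (P : Subgroup Q) (s : Equiv.Perm Y)
    (a : Y → Option ι) (g : Y → Q) (hg : ∀ y i, a y = some i → g y ∉ P) (i : ι) :
    Function.Involutive (swFun P s a g i) := by
  rintro ⟨q, y⟩
  by_cases h1 : q ∈ P ∧ a y = some i
  · have h2 : q * g y ∉ P := fun h => hg y i h1.2 ((P.mul_mem_cancel_left h1.1).1 h)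
    simp [swFun, h1, h2]
  · by_cases h2 : a (s.symm y) = some i ∧ q * (g (s.symm y))⁻¹ ∈ P
    · simp [swFun, h1, h2]
    · simp only [swFun, h1, h2, if_false]

lemma swFun_mul {ι Q Y : Type*} [Group Q] (P : Subgroup Q) (s : Equiv.Perm Y)
    (a : Y → Option ι) (g : Y → Q) (i : ι) (p : Q) (hp : p ∈ P) (q : Q) (y : Y) :
    swFun P s a g i (p * q, y) = (p * (swFun P s a g i (q, y)).1, (swFun P s a g i (q, y)).2) := by
  by_cases h1 : q ∈ P ∧ a y = some i
  · simp [swFun, h1, P.mul_mem hp h1.1, mul_assoc]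
  · have h1' : ¬ (p * q ∈ P ∧ a y = some i) := by
      rwa [P.mul_mem_cancel_left hp]
    by_cases h2 : a (s.symm y) = some i ∧ q * (g (s.symm y))⁻¹ ∈ P
    · have h2' : a (s.symm y) = some i ∧ p * q * (g (s.symm y))⁻¹ ∈ P := by
        rwa [mul_assoc, P.mul_mem_cancel_left hp]
      simp only [swFun, h1, h2, h1', h2', if_false]
      simp [mul_assoc]
    · have h2' : ¬ (a (s.symm y) = some i ∧ p * q * (g (s.symm y))⁻¹ ∈ P) := by
        rwa [mul_assoc, P.mul_mem_cancel_left hp]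
      simp only [swFun, h1, h2, h1', h2', if_false]

/-- left multiplication on the first coordinate -/
def leftHom (Q Y : Type*) [Group Q] : Q →* Equiv.Perm (Q × Y) where
  toFun q := (Equiv.mulLeft q).prodCongr (Equiv.refl Y)
  map_one' := by ext x <;> simp
  map_mul' a b := by ext x <;> simp [mul_assoc]

lemma leftHom_apply {Q Y : Type*} [Group Q] (q : Q) (x : Q × Y) :
    leftHom Q Y q x = (q * x.1, x.2) := rfl

/-- Path lemma. -/
lemma exists_finite_rep {ι G : Type*} {Q : Type v} [Group G] [Group Q] [Finite Q] (p : G →* Q) (P : Subgroup Q)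
    (w : List (Σ _ : ι, G)) (hw : w ≠ [])
    (hch : w.IsChain fun l l' => l.1 ≠ l'.1) (hP : ∀ l ∈ w, p l.2 ∉ P) :
    ∃ (X : Type v) (_ : Finite X) (ρ : ι → Q →* Equiv.Perm X) (ρ0 : P →* Equiv.Perm X),
      (∀ i (q : P), ρ i q = ρ0 q) ∧
      ∀ q : P, ρ0 q * (w.map fun l => ρ l.1 (p l.2)).prod ≠ 1 := by
  let Y := Fin (w.length + 1)
  let s : Equiv.Perm Y := finRotate _
  let a : Y → Option ι := fun y => (w[y.val]?).map Sigma.fst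
  let g : Y → Q := fun y => ((w[y.val]?).map fun l => p l.2).getD 1
  have hg : ∀ y i, a y = some i → g y ∉ P := by
    intro y i h
    simp only [a, g] at h ⊢
    rcases hh : w[y.val]? with _ | l
    · simp [hh] at h
    · simpa [hh] using hP l (List.mem_of_getElem? hh)
  let σ : ι → Equiv.Perm (Q × Y) := fun i => (swFun_invol P s a g hg i).toPerm
  let ρ : ι → Q →* Equiv.Perm (Q × Y) := fun i =>
    (MulAut.conj (σ i)).toMonoidHom.comp (leftHom Q Y)
  have hρ : ∀ i q x, ρ i q x = swFun P s a g i (leftHom Q Y q (swFun P s a g i x)) :=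
    fun i q x => rfl
  refine ⟨Q × Y, inferInstance, ρ, (leftHom Q Y).comp P.subtype, ?_, ?_⟩
  · intro i q
    ext1 x
    rw [hρ, leftHom_apply, swFun_mul P s a g i _ q.2, swFun_invol P s a g hg i]
    rfl
  · have key : ∀ n j, ∀ hj : j + n = w.length,
        ((w.drop j).map fun l => ρ l.1 (p l.2)).prod ((1 : Q), (Fin.last _ : Y))
          = ((1 : Q), (⟨j, by omega⟩ : Y)) := by
      intro n
      induction n with
      | zero =>
        intro j hj
        have : j = w.length := by omega
        subst this
        simp; rfl
      | succ n ih =>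
        intro j hj
        have hjl : j < w.length := by omega
        rw [List.drop_eq_getElem_cons hjl, List.map_cons, List.prod_cons, Equiv.Perm.mul_apply,
          ih (j+1) (by omega), hρ]
        have hs : s (⟨j, by omega⟩ : Y) = (⟨j+1, by omega⟩ : Y) := by
          simp only [s, Y]
          exact finRotate_of_lt hjl
        have hs' : s.symm (⟨j+1, by omega⟩ : Y) = (⟨j, by omega⟩ : Y) := by
          rw [← hs, Equiv.symm_apply_apply]
        have haj : a (⟨j, by omega⟩ : Y) = some w[j].1 := by
          simp [a, hjl]
        have hgj : g (⟨j, by omega⟩ : Y) = p w[j].2 := by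
          simp [g, hjl]
        have hne : a (⟨j+1, by omega⟩ : Y) ≠ some w[j].1 := by
          intro h
          by_cases h1 : j + 1 < w.length
          · simp [a, h1] at h
            exact (List.isChain_iff_getElem.1 hch j h1) h.symm
          · simp [a, h1] at h
        have hnP : p w[j].2 ∉ P := hP _ (List.getElem_mem hjl)
        have e1 : swFun P s a g w[j].1 ((1 : Q), (⟨j+1, by omega⟩ : Y))
            = ((1 : Q), (⟨j+1, by omega⟩ : Y)) := by
          simp [swFun, hne, hs', hgj, hnP]
        rw [e1, leftHom_apply]
        simp [swFun, hs', hgj, hnP, haj]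
    intro q h
    have := key w.length 0 (by omega)
    rw [List.drop_zero] at this
    have h2 := congrArg (fun f => f ((1 : Q), (Fin.last _ : Y))) h
    rw [Equiv.Perm.mul_apply, this] at h2
    have h3 := congrArg (fun z => z.2.val) h2
    have h4 : (0 : ℕ) = w.length := h3
    exact hw (List.length_eq_zero_iff.1 h4.symm)

lemma permDist_permCongr {A B : Type*} (e : A ≃ B) (σ τ : Equiv.Perm A) :
    permDist (e.permCongr σ) (e.permCongr τ) = permDist σ τ := by
  unfold permDist
  rw [Nat.card_congr e]
  congr 2
  rw [← Set.ncard_image_of_injective _ e.injective]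
  congr 1
  ext b
  simp only [Set.mem_ofPred_eq, Set.mem_image]
  constructor
  · intro h
    exact ⟨e.symm b, by simpa [Equiv.permCongr_apply] using h, by simp⟩
  · rintro ⟨a, ha, rfl⟩
    simpa [Equiv.permCongr_apply] using ha

lemma isSofic_of_approx {G : Type*} [Group G]
    (h : ∀ (F : Finset G) (ε : ℝ), 0 < ε →
    ∃ A : Type v, Finite A ∧ Nonempty A ∧ ∃ φ : G → Equiv.Perm A,
      φ 1 = 1 ∧
      (∀ g ∈ F, ∀ h ∈ F, permDist (φ (g * h)) (φ g * φ h) < ε) ∧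
      (∀ g ∈ F, g ≠ 1 → 1 - ε < permDist (φ g) 1)) : IsSofic G := by
  intro F ε hε
  obtain ⟨A, hA, hA', φ, h1, h2, h3⟩ := h F ε hε
  have e := Finite.equivFin A
  have hmul : ∀ σ τ : Equiv.Perm A, e.permCongr (σ * τ) = e.permCongr σ * e.permCongr τ := by
    intro σ τ; ext x; simp [Equiv.permCongr_apply]
  have hone : e.permCongr (1 : Equiv.Perm A) = 1 := by
    ext x; simp [Equiv.permCongr_apply]
  refine ⟨Fin (Nat.card A), inferInstance, ⟨e hA'.some⟩, fun g => e.permCongr (φ g), ?_, ?_, ?_⟩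
  · simp only [h1, hone]
  · intro g hg k hk
    rw [← hmul, permDist_permCongr]
    exact h2 g hg k hk
  · intro g hg hg1
    rw [← hone, permDist_permCongr]
    exact h3 g hg hg1

lemma permDist_prod_s17 {A M : Type*} [Finite A] [Finite M] [Nonempty M] (σ τ : Equiv.Perm A)
    (μ : Equiv.Perm M) :
    permDist (σ.prodCongr μ) (τ.prodCongr μ) = permDist σ τ := by
  unfold permDist
  have : {x : A × M | (σ.prodCongr μ) x ≠ (τ.prodCongr μ) x} = {a | σ a ≠ τ a} ×ˢ Set.univ := by
    ext x; simp [Prod.ext_iff]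
  rw [this, Set.ncard_prod, Set.ncard_univ, Nat.card_prod]
  push_cast
  have : (Nat.card M : ℝ) ≠ 0 := by exact_mod_cast Nat.card_pos.ne'
  rw [mul_div_mul_right _ _ this]

lemma permDist_mono {A : Type*} [Finite A] (σ τ σ' τ' : Equiv.Perm A)
    (h : ∀ a, σ a ≠ τ a → σ' a ≠ τ' a) : permDist σ τ ≤ permDist σ' τ' := by
  unfold permDist
  refine div_le_div_of_nonneg_right ?_ (Nat.cast_nonneg _)
  exact_mod_cast Set.ncard_le_ncard (fun a ha => h a ha) (Set.toFinite _)

lemma isSofic_of_residual {Γ G : Type*} [Group Γ] [Group G] (hG : IsSofic G) (π : Γ →* G)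
    (h : ∀ x : Γ, x ≠ 1 → π x ≠ 1 ∨ ∃ N : Subgroup Γ, N.FiniteIndex ∧ x ∉ N) : IsSofic Γ := by
  classical
  refine isSofic_of_approx fun F ε hε => ?_
  have h' : ∀ x : Γ, ∃ N : Subgroup Γ, N.FiniteIndex ∧ (x ≠ 1 → π x ≠ 1 ∨ x ∉ N) := by
    intro x
    by_cases hx : x = 1
    · exact ⟨⊤, inferInstance, fun h => absurd hx h⟩
    · rcases h x hx with h | ⟨N, hN, hxN⟩
      · exact ⟨⊤, inferInstance, fun _ => Or.inl h⟩
      · exact ⟨N, hN, fun _ => Or.inr hxN⟩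
  choose N hN hxN using h'
  let K : Subgroup Γ := ⨅ x ∈ F, N x
  have hK : K.FiniteIndex := Subgroup.finiteIndex_iInf' _ fun x _ => hN x
  let M := Γ ⧸ K.normalCore
  let f : Γ →* M := QuotientGroup.mk' _
  have hf : ∀ x ∈ F, x ≠ 1 → π x ≠ 1 ∨ f x ≠ 1 := by
    intro x hx hx1
    refine (hxN x hx1).imp id fun h hh => h ?_
    have h2 : x ∈ K := K.normalCore_le ((QuotientGroup.eq_one_iff x).1 hh)
    simp only [K, Subgroup.mem_iInf] at h2
    exact h2 x hx
  obtain ⟨A, hA, hA', φ, h1, h2, h3⟩ := hG (F.image π) ε hε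
  refine ⟨A × M, inferInstance, inferInstance,
    fun x => (φ (π x)).prodCongr (Equiv.mulLeft (f x)), ?_, ?_, ?_⟩
  · ext x <;> simp [h1]
  · intro x hx y hy
    have e : (φ (π x)).prodCongr (Equiv.mulLeft (f x)) * (φ (π y)).prodCongr (Equiv.mulLeft (f y))
      = (φ (π x) * φ (π y)).prodCongr (Equiv.mulLeft (f (x * y))) := by
      ext z <;> simp [mul_assoc]
    rw [e, permDist_prod_s17, map_mul]
    exact h2 _ (Finset.mem_image_of_mem _ hx) _ (Finset.mem_image_of_mem _ hy)
  · intro x hx hx1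
    rcases hf x hx hx1 with h | h
    · refine (h3 _ (Finset.mem_image_of_mem _ hx) h).trans_le ?_
      rw [← permDist_prod_s17 (φ (π x)) 1 (1 : Equiv.Perm M)]
      refine permDist_mono _ _ _ _ fun z hz => ?_
      simp [Prod.ext_iff] at hz ⊢
      exact fun h => absurd h hz
    · have : {z : A × M | ((φ (π x)).prodCongr (Equiv.mulLeft (f x))) z
          ≠ (1 : Equiv.Perm (A × M)) z} = Set.univ := by
        ext z
        simp [Prod.ext_iff, h]
      unfold permDist
      rw [this, Set.ncard_univ, div_self]
      · linarith
      · exact_mod_cast Nat.card_pos.ne'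

lemma exists_separating {ι G : Type*} [Group G] (H : Subgroup G)
    (hsep : ∀ g, g ∉ H → ∃ L : Subgroup G, L.FiniteIndex ∧ H ≤ L ∧ g ∉ L)
    (w : List (Σ _ : ι, G)) (hw : ∀ l ∈ w, l.2 ∉ H) :
    ∃ L : Subgroup G, L.FiniteIndex ∧ H ≤ L ∧ ∀ l ∈ w, l.2 ∉ L := by
  induction w with
  | nil => exact ⟨⊤, inferInstance, le_top, by simp⟩
  | cons a w ih =>
    obtain ⟨L, h1, h2, h3⟩ := ih fun l hl => hw l (List.mem_cons_of_mem _ hl)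
    obtain ⟨L', h1', h2', h3'⟩ := hsep a.2 (hw a List.mem_cons_self)
    refine ⟨L ⊓ L', inferInstance, le_inf h2 h2', ?_⟩
    intro l hl
    rcases List.mem_cons.1 hl with rfl | hl
    · exact fun h => h3' h.2
    · exact fun h => h3 l hl h.1

open Monoid in
lemma isSofic_pushout_aux {ι G : Type*} [Group G] (hG : IsSofic G) (H : Subgroup G)
    (hsep : ∀ g, g ∉ H → ∃ L : Subgroup G, L.FiniteIndex ∧ H ≤ L ∧ g ∉ L) :
    IsSofic (PushoutI (fun _ : ι => H.subtype)) := by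
  classical
  let π : PushoutI (fun _ : ι => H.subtype) →* G :=
    PushoutI.lift (fun _ => MonoidHom.id G) H.subtype (fun _ => rfl)
  refine isSofic_of_residual hG π fun x hx => ?_
  obtain ⟨d⟩ := PushoutI.NormalWord.transversal_nonempty (fun _ : ι => H.subtype)
    (fun _ => H.subtype_injective)
  obtain ⟨w, rfl⟩ := (PushoutI.NormalWord.equiv (d := d)).symm.surjective x
  have hprod : (PushoutI.NormalWord.equiv (d := d)).symm w
      = PushoutI.base _ w.head * (w.toList.map fun l => PushoutI.of l.1 l.2).prod := by
    change PushoutI.NormalWord.prod w = _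
    rw [PushoutI.NormalWord.prod, CoprodI.Word.prod, map_list_prod, List.map_map]
    congr 3
  rw [hprod] at hx ⊢
  have hlet : ∀ l ∈ w.toList, l.2 ∉ H := by
    intro l hl hlH
    apply w.ne_one l hl
    have h1 := w.normalized l.1 l.2 hl
    have h2 : l.2 ∈ (H.subtype).range := by simpa using hlH
    have := (d.compl l.1).1 (a₁ := (⟨l.2, h2⟩, ⟨1, d.one_mem _⟩)) (a₂ := (⟨1, one_mem _⟩, ⟨l.2, h1⟩))
      (by simp)
    have := congrArg (fun z => (z.2 : G)) this
    simpa using this.symm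
  by_cases hnil : w.toList = []
  · left
    simp only [hnil, List.map_nil, List.prod_nil, mul_one] at hx ⊢
    simp only [π, PushoutI.lift_base]
    intro h
    apply hx
    have : w.head = 1 := Subtype.ext h
    rw [this, map_one]
  · right
    obtain ⟨L, hL, hHL, hwL⟩ := exists_separating H hsep w.toList hlet
    let p : G →* G ⧸ L.normalCore := QuotientGroup.mk' _
    have hp : ∀ g, p g ∈ L.map p → g ∈ L := by
      rintro g ⟨k, hk, hkg⟩
      have := L.normalCore_le (QuotientGroup.eq.1 hkg)
      exact (L.mul_mem_cancel_left (L.inv_mem hk)).1 this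
    obtain ⟨X, hX, ρ, ρ0, h1, h2⟩ := exists_finite_rep p (L.map p) w.toList hnil w.chain_ne
      (fun l hl h => hwL l hl (hp _ h))
    let q : H →* L.map p := (p.comp H.subtype).codRestrict _
      (fun h => Subgroup.mem_map_of_mem p (hHL h.2))
    let Φ : PushoutI (fun _ : ι => H.subtype) →* Equiv.Perm X :=
      PushoutI.lift (fun i => (ρ i).comp p) (ρ0.comp q) (fun i => by
        ext1 h
        exact h1 i (q h))
    refine ⟨Φ.ker, inferInstance, fun h => h2 (q w.head) ?_⟩
    rw [MonoidHom.mem_ker, map_mul, map_list_prod, List.map_map] at h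
    rw [← h]
    congr 1

/-- If `G` is a countable sofic group and `H` is a separable subgroup of `G`, then the
amalgamated free product of countably infinitely many copies of `G` over `H` is sofic.
In particular, the double `G ∗_H G` over a finite-index subgroup is sofic. -/
theorem isSofic_pushoutI_of_separable {G : Type*} [Group G] [Countable G]
    (hG : IsSofic G) (H : Subgroup G) (Gi : ℕ → Subgroup G)
    (hfi : ∀ i, (Gi i).FiniteIndex) (hinf : ⨅ i, Gi i = H) :
    IsSofic (Monoid.PushoutI (fun _ : ℕ => H.subtype)) ∧
      ∀ H' : Subgroup G, H'.FiniteIndex →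
        IsSofic (Monoid.PushoutI (fun _ : Bool => H'.subtype)) := by
  refine ⟨isSofic_pushout_aux hG H fun g hg => ?_, fun H' hH' =>
    isSofic_pushout_aux hG H' fun g hg => ⟨H', hH', le_rfl, hg⟩⟩
  rw [← hinf, Subgroup.mem_iInf] at hg
  push Not at hg
  obtain ⟨i, hi⟩ := hg
  exact ⟨Gi i, hfi i, hinf ▸ iInf_le _ _, hi⟩
end
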